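/- arXiv:1611.01569 — 12 statements merged into one kernel-verified Lean document; each statement's English description precedes it below -/
import Mathlib

section
/- Structure Lemma (i): Let F be a field, n, M ≥ 1, let R be an n×n matrix over F with characteristic polynomial c_R(X), and let G and H be M×M matrices with entries in the polynomial ring F[X] such that H·G ≡ I entrywise modulo c_R(X) (i.e., c_R(X) divides every entry of H·G − I in F[X]). Suppose vectors a_0,…,a_{M−1} and f_0,…,f_{M−1} in F^n satisfy Σ_{j=0}^{M−1} (G[i,j])(R)·a_j = f_i for every 0 ≤ i < M. Then a_i = Σ_{j=0}^{M−1} (H[i,j])(R)·f_j for every 0 ≤ i < M. -/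
open Polynomial Matrix

/-- **Structure Lemma (i).** If `H·G ≡ I` entrywise modulo the characteristic polynomial of `R`,
and the vectors `a i` satisfy `∑ j, (G i j)(R) · a j = f i`, then
`a i = ∑ j, (H i j)(R) · f j`. -/
theorem structure_lemma_i
    (F : Type*) [Field F] (n M : ℕ) (hn : 1 ≤ n) (hM : 1 ≤ M)
    (R : Matrix (Fin n) (Fin n) F)
    (G H : Matrix (Fin M) (Fin M) (Polynomial F))
    (hHG : ∀ i j : Fin M,
      R.charpoly ∣ ((H * G) i j - (1 : Matrix (Fin M) (Fin M) (Polynomial F)) i j))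
    (a f : Fin M → Fin n → F)
    (hrec : ∀ i : Fin M,
      ∑ j : Fin M, (Polynomial.aeval R (G i j)).mulVec (a j) = f i) :
    ∀ i : Fin M, a i = ∑ j : Fin M, (Polynomial.aeval R (H i j)).mulVec (f j) := by
  intro i
  have key : ∀ k : Fin M, Polynomial.aeval R ((H * G) i k)
      = Polynomial.aeval R ((1 : Matrix (Fin M) (Fin M) (Polynomial F)) i k) := by
    intro k
    obtain ⟨q, hq⟩ := hHG i k
    have h := congrArg (Polynomial.aeval R) hq
    rw [map_sub, map_mul, Matrix.aeval_self_charpoly, zero_mul] at h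
    exact sub_eq_zero.mp h
  have h1 : ∑ j : Fin M, (Polynomial.aeval R (H i j)).mulVec (f j)
      = ∑ k : Fin M, (Polynomial.aeval R ((H * G) i k)).mulVec (a k) := by
    simp_rw [← hrec, Matrix.mulVec_sum, Matrix.mulVec_mulVec, ← map_mul]
    rw [Finset.sum_comm]
    refine Finset.sum_congr rfl fun k _ => ?_
    rw [Matrix.mul_apply, map_sum, Matrix.sum_mulVec]
  rw [h1]
  simp_rw [key]
  rw [Finset.sum_eq_single i]
  · simp
  · intro k _ hk
    rw [Matrix.one_apply_ne hk.symm, map_zero, Matrix.zero_mulVec]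
  · simp
end

section
/- Structure Lemma (ii): Let 𝓡 be a commutative ring, t ≥ 1, N ≥ 1, and let elements g_{i,j} ∈ 𝓡 be given for 1 ≤ i ≤ N−1 and 1 ≤ j ≤ min(i,t). Let G be the N×N unit lower-triangular t-banded matrix with G[i,i] = 1, G[i,j] = −g_{i,i−j} for max(0, i−t) ≤ j < i, and G[i,j] = 0 otherwise. Then G is invertible over 𝓡, G^{-1}[i,j] = 0 for j > i, and for every 0 ≤ j ≤ i ≤ N−1 the entry G^{-1}[i,j] equals the bottom-right entry T_{[j:i]}[t−1, t−1] of the ranged transition matrix. -/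
open Matrix

/-- The transition matrix `T_i`: a `t × t` matrix whose superdiagonal entries are `1`
and whose last row contains `g (i+1) (t - b)` in column `b`. -/
def transitionMatrix (R : Type*) [CommRing R] (t : ℕ) (g : ℕ → ℕ → R) (i : ℕ) :
    Matrix (Fin t) (Fin t) R :=
  Matrix.of fun a b =>
    if (a : ℕ) = t - 1 then g (i + 1) (t - (b : ℕ))
    else if (b : ℕ) = (a : ℕ) + 1 then 1 else 0

/-- The ranged transition matrix `T_{[ℓ:r]} = T_{r-1} · T_{r-2} ⋯ T_ℓ`
(the identity when `r = ℓ`). -/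
def rangedTransition (R : Type*) [CommRing R] (t : ℕ) (g : ℕ → ℕ → R) (ℓ r : ℕ) :
    Matrix (Fin t) (Fin t) R :=
  ((List.range (r - ℓ)).map fun k => transitionMatrix R t g (r - 1 - k)).prod

theorem rt_self (R : Type*) [CommRing R] (t : ℕ) (g : ℕ → ℕ → R) (j : ℕ) :
    rangedTransition R t g j j = 1 := by
  simp [rangedTransition]

theorem rt_succ (R : Type*) [CommRing R] (t : ℕ) (g : ℕ → ℕ → R) (j i : ℕ) (h : j ≤ i) :
    rangedTransition R t g j (i + 1) =
      transitionMatrix R t g i * rangedTransition R t g j i := by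
  unfold rangedTransition
  rw [Nat.succ_sub h, List.range_succ_eq_map, List.map_cons, List.prod_cons, List.map_map]
  congr 3
  funext k
  simp only [Function.comp]
  congr 1
  omega

/-- entry of the claimed inverse -/
def invEntry (R : Type*) [CommRing R] (t : ℕ) (ht : 1 ≤ t) (g : ℕ → ℕ → R) (j k : ℕ) : R :=
  if j ≤ k then rangedTransition R t g j k ⟨t - 1, by omega⟩ ⟨t - 1, by omega⟩ else 0

theorem rt_col (R : Type*) [CommRing R] (t : ℕ) (ht : 1 ≤ t) (g : ℕ → ℕ → R) (j m : ℕ) :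
    ∀ d (hd : d < t), rangedTransition R t g j (j + m) ⟨t - 1 - d, by omega⟩ ⟨t - 1, by omega⟩ =
      if d ≤ m then invEntry R t ht g j (j + m - d) else 0 := by
  induction m with
  | zero =>
    intro d hd
    rcases Nat.eq_zero_or_pos d with rfl | h
    · simp [invEntry]
    · rw [if_neg (by omega), Nat.add_zero, rt_self, Matrix.one_apply_ne]
      intro h'
      have := congrArg Fin.val h'
      simp at this
      omega
  | succ m ih =>
    intro d hd
    rcases Nat.eq_zero_or_pos d with rfl | h
    · simp [invEntry]
    · obtain ⟨e, rfl⟩ : ∃ e, d = e + 1 := ⟨d - 1, by omega⟩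
      have := ih e (by omega)
      rw [← Nat.add_assoc, rt_succ _ _ _ _ _ (by omega), Matrix.mul_apply,
        Finset.sum_eq_single (⟨t - 1 - e, by omega⟩ : Fin t)]
      · rw [this]
        have h1 : j + m + 1 - (e + 1) = j + m - e := by omega
        rw [h1]
        simp only [transitionMatrix, Matrix.of_apply]
        rw [if_neg (by omega), if_pos (by omega), one_mul]
        simp
      · intro b _ hb
        have hb' : (b : ℕ) ≠ t - 1 - e := fun h' => hb (Fin.ext h')
        simp only [transitionMatrix, Matrix.of_apply]
        rw [if_neg (by omega), if_neg (by omega), zero_mul]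
      · simp

theorem invEntry_rec (R : Type*) [CommRing R] (t : ℕ) (ht : 1 ≤ t) (g : ℕ → ℕ → R)
    (hg : ∀ i j : ℕ, (i < j ∨ t < j) → g i j = 0) (j i : ℕ) (h : j ≤ i) :
    invEntry R t ht g j (i + 1) =
      ∑ k ∈ Finset.range (i + 1), g (i + 1) (i + 1 - k) * invEntry R t ht g j k := by
  have key : invEntry R t ht g j (i + 1) =
      ∑ d ∈ Finset.range t, g (i + 1) (d + 1) * invEntry R t ht g j (i - d) := by
    rw [invEntry, if_pos (by omega), rt_succ _ _ _ _ _ h, Matrix.mul_apply,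
      Finset.sum_range, ← Equiv.sum_comp Fin.revPerm]
    refine Finset.sum_congr rfl fun d _ => ?_
    obtain ⟨m, rfl⟩ : ∃ m, i = j + m := ⟨i - j, by omega⟩
    have hc := rt_col R t ht g j m d d.2
    have hr : Fin.revPerm d = ⟨t - 1 - d, by omega⟩ := by
      apply Fin.ext
      simp [Fin.val_rev]
      omega
    rw [hr, hc]
    simp only [transitionMatrix, Matrix.of_apply, if_true]
    have h1 : t - (t - 1 - (d : ℕ)) = d + 1 := by omega
    rw [h1]
    split_ifs with h2
    · rfl
    · by_cases h3 : j + m < (d : ℕ)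
      · rw [hg _ _ (Or.inl (by omega))]; simp
      · rw [invEntry, if_neg (by omega)]
  rw [key, ← Finset.sum_range_reflect _ (i + 1)]
  have e1 : ∀ d ∈ Finset.range (i + 1),
      g (i + 1) (i + 1 - (i + 1 - 1 - d)) * invEntry R t ht g j (i + 1 - 1 - d) =
      g (i + 1) (d + 1) * invEntry R t ht g j (i - d) := by
    intro d hd
    rw [Finset.mem_range] at hd
    congr 2
    omega
  rw [Finset.sum_congr rfl e1]
  rw [Finset.sum_subset (Finset.range_mono (show t ≤ t + (i + 1) by omega)),
    Finset.sum_subset (Finset.range_mono (show i + 1 ≤ t + (i + 1) by omega))]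
  · intro d _ hd
    rw [Finset.mem_range] at hd
    rw [hg _ _ (Or.inl (by omega)), zero_mul]
  · intro d _ hd
    rw [Finset.mem_range] at hd
    rw [hg _ _ (Or.inr (by omega)), zero_mul]

theorem G_mul_inv
    (R : Type*) [CommRing R] (t N : ℕ) (ht : 1 ≤ t)
    (g : ℕ → ℕ → R) (hg : ∀ i j : ℕ, (i < j ∨ t < j) → g i j = 0)
    (G : Matrix (Fin N) (Fin N) R)
    (hG : ∀ i j : Fin N, G i j =
      if i = j then 1
      else if (j : ℕ) < (i : ℕ) ∧ (i : ℕ) ≤ (j : ℕ) + t then -g (i : ℕ) ((i : ℕ) - (j : ℕ))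
      else 0) :
    G * Matrix.of (fun i j : Fin N => invEntry R t ht g j i) = 1 := by
  ext i j
  have hs : (G * Matrix.of (fun i j : Fin N => invEntry R t ht g j i)) i j =
      invEntry R t ht g j i -
        ∑ k ∈ Finset.range (i : ℕ), g i (i - k) * invEntry R t ht g j k := by
    have hsub : ∑ k ∈ Finset.range (i : ℕ), g i (i - k) * invEntry R t ht g j k =
        ∑ k ∈ Finset.range N,
          if k < (i : ℕ) then g i (i - k) * invEntry R t ht g j k else 0 := by
      rw [← Finset.sum_filter]
      refine Finset.sum_congr ?_ fun _ _ => rfl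
      ext k
      have := i.2
      simp only [Finset.mem_range, Finset.mem_filter]
      omega
    have hd : invEntry R t ht g j i =
        ∑ k : Fin N, if i = k then invEntry R t ht g j k else 0 := by simp
    rw [hsub, hd, Finset.sum_range, ← Finset.sum_sub_distrib, Matrix.mul_apply]
    refine Finset.sum_congr rfl fun k _ => ?_
    rw [hG, Matrix.of_apply]
    by_cases h1 : i = k
    · subst h1; simp
    · by_cases h2 : (k : ℕ) < i
      · by_cases h3 : (i : ℕ) ≤ k + t
        · simp [h1, h2, h3]
        · rw [hg i (i - k) (Or.inr (by omega))]
          simp [h1]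
      · simp [h1, h2]
  rw [hs]
  rcases lt_trichotomy (i : ℕ) j with h | h | h
  · rw [Matrix.one_apply_ne (fun e => by subst e; omega), invEntry, if_neg (by omega),
      Finset.sum_eq_zero, sub_zero]
    intro k hk
    rw [Finset.mem_range] at hk
    rw [invEntry, if_neg (by omega), mul_zero]
  · have e : i = j := Fin.ext h
    subst e
    rw [Matrix.one_apply_eq, Finset.sum_eq_zero, invEntry, if_pos le_rfl, rt_self,
      Matrix.one_apply_eq, sub_zero]
    intro k hk
    rw [Finset.mem_range] at hk
    rw [invEntry, if_neg (by omega), mul_zero]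
  · rw [Matrix.one_apply_ne (fun e => by subst e; omega)]
    obtain ⟨m, hm⟩ : ∃ m, (i : ℕ) = m + 1 := ⟨i - 1, by omega⟩
    rw [hm, invEntry_rec R t ht g hg j m (by omega), sub_self]

/-- **Structure Lemma (ii).** The unit lower-triangular `t`-banded matrix `G` built from the
recurrence coefficients `g` is invertible, its inverse is lower triangular, and the entry
`G⁻¹[i,j]` (for `j ≤ i`) is the bottom-right entry of the ranged transition matrix
`T_{[j:i]}`. -/
theorem structure_lemma_ii
    (R : Type*) [CommRing R] (t N : ℕ) (ht : 1 ≤ t) (hN : 1 ≤ N)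
    (g : ℕ → ℕ → R) (hg : ∀ i j : ℕ, (i < j ∨ t < j) → g i j = 0)
    (G : Matrix (Fin N) (Fin N) R)
    (hG : ∀ i j : Fin N, G i j =
      if i = j then 1
      else if (j : ℕ) < (i : ℕ) ∧ (i : ℕ) ≤ (j : ℕ) + t then -g (i : ℕ) ((i : ℕ) - (j : ℕ))
      else 0) :
    IsUnit G ∧ (∀ i j : Fin N, (i : ℕ) < (j : ℕ) → G⁻¹ i j = 0) ∧
      ∀ i j : Fin N, (j : ℕ) ≤ (i : ℕ) →
        G⁻¹ i j =
          rangedTransition R t g (j : ℕ) (i : ℕ) ⟨t - 1, by omega⟩ ⟨t - 1, by omega⟩ := by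
  have h := G_mul_inv R t N ht g hg G hG
  have hinv := Matrix.inv_eq_right_inv h
  refine ⟨IsUnit.of_mul_eq_one _ h, ?_, ?_⟩
  · intro i j hij
    rw [hinv, Matrix.of_apply, invEntry, if_neg (by omega)]
  · intro i j hij
    rw [hinv, Matrix.of_apply, invEntry, if_pos hij]
end

section
/- Hierarchy of recurrence width (separation theorem): For every t ≥ 1 and every N that is a positive multiple of 2(t+1), there exists a family f = (a_0,…,a_{N−1}) ∈ P(t+1) — one may take a_i = X^i when (t+1) divides i and a_i = 0 otherwise — such that for every family g = (b_0,…,b_{N−1}) ∈ P(t), Σ_{i=0}^{N−1} (a_i(1) − b_i(1))² ≥ N/(2(t+1)) − 1; equivalently, ‖M(f)·1 − M(g)·1‖₂² ≥ N/(2(t+1)) − 1, where 1 is the all-ones vector. Thus no recurrence-width-t family can approximate the action of this recurrence-width-(t+1) matrix on the all-ones vector. -/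
open Polynomial

/-- `P(t)` for length-`N` families: `a₀, …, a_{N−1} ∈ ℤ[X]` with `deg aᵢ ≤ i`, satisfying a
width-`t` polynomial recurrence `aᵢ = ∑_{j=1}^{t} g_{i,j} · a_{i−j}` (with `deg g_{i,j} ≤ j`)
for all `t ≤ i ≤ N−1`. -/
def IsRecWidthFamily (N t : ℕ) (a : ℕ → Polynomial ℤ) : Prop :=
  (∀ i, i < N → (a i).degree ≤ (i : WithBot ℕ)) ∧
  ∃ g : ℕ → ℕ → Polynomial ℤ,
    (∀ i j : ℕ, (g i j).degree ≤ (j : WithBot ℕ)) ∧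
    ∀ i, t ≤ i → i < N → a i = ∑ j ∈ Finset.Icc 1 t, g i j * a (i - j)

/-- **Hierarchy of recurrence width (separation).** For every `t ≥ 1` and every `N` a positive
multiple of `2(t+1)`, there is a family in `P(t+1)` — namely `aᵢ = Xⁱ` when `(t+1) ∣ i` and
`aᵢ = 0` otherwise — such that for every family `b ∈ P(t)`,
`∑ᵢ (aᵢ(1) − bᵢ(1))² ≥ N/(2(t+1)) − 1`. -/
theorem recurrence_width_hierarchy
    (t N : ℕ) (ht : 1 ≤ t) (hN : ∃ k, 0 < k ∧ N = 2 * (t + 1) * k) :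
    ∃ a : ℕ → Polynomial ℤ, IsRecWidthFamily N (t + 1) a ∧
      (∀ i, i < N → a i = if (t + 1) ∣ i then X ^ i else 0) ∧
      ∀ b : ℕ → Polynomial ℤ, IsRecWidthFamily N t b →
        (N : ℝ) / (2 * ((t : ℝ) + 1)) - 1 ≤
          ((∑ i ∈ Finset.range N, ((a i).eval 1 - (b i).eval 1) ^ 2 : ℤ) : ℝ) := by
  obtain ⟨k, hk, rfl⟩ := hN
  refine ⟨fun i => if (t + 1) ∣ i then X ^ i else 0, ⟨?_, ?_⟩, fun i _ => rfl, ?_⟩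
  · intro i _
    dsimp only
    split_ifs
    · exact degree_X_pow_le i
    · simp
  · refine ⟨fun _ j => if j = t + 1 then X ^ (t + 1) else 0, ?_, ?_⟩
    · intro i j
      dsimp only
      split_ifs with h
      · subst h
        exact degree_X_pow_le _
      · simp
    · intro i hi _
      rw [Finset.sum_eq_single (t + 1)]
      · have h : (t + 1 ∣ i - (t + 1)) ↔ (t + 1 ∣ i) := Nat.dvd_sub_iff_left hi (dvd_refl _)
        simp only [h, if_true]
        split_ifs
        · rw [← pow_add]
          congr 1
          omega
        · simp
      · intro j _ hj
        simp [hj]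
      · intro h
        simp at h
  · rintro b ⟨_, g, _, hrec⟩
    set e : ℕ → ℤ := fun i =>
      ((if (t + 1) ∣ i then X ^ i else 0 : Polynomial ℤ).eval 1 - (b i).eval 1) ^ 2 with he
    have hnn : ∀ i, 0 ≤ e i := fun i => sq_nonneg _
    have hwin : ∀ m, (m + 1) * (t + 1) < 2 * (t + 1) * k →
        1 ≤ ∑ r ∈ Finset.range (t + 1), e (m * (t + 1) + 1 + r) := by
      intro m hm
      by_contra hlt
      have hz : ∀ r ∈ Finset.range (t + 1), e (m * (t + 1) + 1 + r) = 0 := by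
        intro r hr
        have h1 := Finset.single_le_sum
          (f := fun r => e (m * (t + 1) + 1 + r)) (fun r _ => hnn _) hr
        have h2 := hnn (m * (t + 1) + 1 + r)
        omega
      have hlast := hz t (by simp)
      have hidx : m * (t + 1) + 1 + t = (m + 1) * (t + 1) := by ring
      have hb : (b ((m + 1) * (t + 1))).eval 1 = 0 := by
        rw [hrec _ (by nlinarith) hm, eval_finsetSum]
        refine Finset.sum_eq_zero fun j hj => ?_
        rw [Finset.mem_Icc] at hj
        have hz' := hz (t - j) (Finset.mem_range.2 (by omega))
        have hij : m * (t + 1) + 1 + (t - j) = (m + 1) * (t + 1) - j := by omega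
        have hnd : ¬ (t + 1) ∣ m * (t + 1) + 1 + (t - j) := by
          rw [add_assoc, Nat.dvd_add_right (Dvd.intro_left m rfl)]
          intro hd
          have := Nat.le_of_dvd (by omega) hd
          omega
        simp only [he, if_neg hnd] at hz'
        rw [hij] at hz'
        simp at hz'
        rw [eval_mul, hz', mul_zero]
      rw [hidx] at hlast
      simp [he, hb] at hlast
    have hsum : ∀ m, m * (t + 1) < 2 * (t + 1) * k →
        (m : ℤ) ≤ ∑ i ∈ Finset.range (m * (t + 1) + 1), e i := by
      intro m
      induction m with
      | zero => intro _; simpa using hnn 0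
      | succ m ih =>
        intro hm
        have h1 := ih (by nlinarith)
        have h2 := hwin m hm
        have h3 : (m + 1) * (t + 1) + 1 = (m * (t + 1) + 1) + (t + 1) := by ring
        rw [h3, Finset.sum_range_add]
        push_cast
        linarith
    obtain ⟨q, rfl⟩ : ∃ q, k = q + 1 := ⟨k - 1, by omega⟩
    have hq : q * (t + 1) < 2 * (t + 1) * (q + 1) := by nlinarith
    have h1 := hsum q hq
    have h2 : ∑ i ∈ Finset.range (q * (t + 1) + 1), e i ≤
        ∑ i ∈ Finset.range (2 * (t + 1) * (q + 1)), e i :=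
      Finset.sum_le_sum_of_subset_of_nonneg (Finset.range_mono hq) (fun i _ _ => hnn i)
    have h3 : ((2 * (t + 1) * (q + 1) : ℕ) : ℝ) / (2 * ((t : ℝ) + 1)) - 1 = ((q : ℤ) : ℝ) := by
      have : (t : ℝ) + 1 ≠ 0 := by positivity
      push_cast
      field_simp
      ring
    rw [h3]
    exact_mod_cast h1.trans h2
end

section
/- Hierarchy of recurrence width (rank separation): For every t ≥ 1 and every N that is a positive multiple of 2(t+1), there exists a family f ∈ P(t+1) — one may take a_i = X^i when (t+1) divides i and a_i = 0 otherwise — such that for every family g ∈ P(t), the lower-triangular matrix M(f) − M(g) has rank (as a matrix over ℚ) at least N/(2(t+1)) − 1. -/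
open Polynomial

/-- **Hierarchy of recurrence width (rank separation).** For every `t ≥ 1` and every `N` a
positive multiple of `2(t+1)`, there is a family in `P(t+1)` — namely `aᵢ = Xⁱ` when
`(t+1) ∣ i` and `aᵢ = 0` otherwise — such that for every `b ∈ P(t)`, the coefficient matrix
`M(a) − M(b)`, viewed over `ℚ`, has rank at least `N/(2(t+1)) − 1`. -/
theorem recurrence_width_rank_hierarchy
    (t N : ℕ) (ht : 1 ≤ t) (hN : ∃ k, 0 < k ∧ N = 2 * (t + 1) * k) :
    ∃ a : ℕ → Polynomial ℤ, IsRecWidthFamily N (t + 1) a ∧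
      (∀ i, i < N → a i = if (t + 1) ∣ i then X ^ i else 0) ∧
      ∀ b : ℕ → Polynomial ℤ, IsRecWidthFamily N t b →
        (N : ℝ) / (2 * ((t : ℝ) + 1)) - 1 ≤
          (((Matrix.of fun i j : Fin N => ((a i).coeff (j : ℕ) : ℚ)) -
            (Matrix.of fun i j : Fin N => ((b i).coeff (j : ℕ) : ℚ))).rank : ℝ) := by
  obtain ⟨k, hk, hN⟩ := hN
  have hadeg : ∀ i : ℕ, (if (t + 1) ∣ i then X ^ i else 0 : Polynomial ℤ).degree ≤ (i : WithBot ℕ) := by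
    intro i
    split_ifs
    · exact degree_X_pow_le i
    · simp
  refine ⟨fun i => if (t + 1) ∣ i then X ^ i else 0, ⟨fun i _ => hadeg i,
    fun i j => if j = t + 1 then X ^ (t + 1) else 0, ?_, ?_⟩, fun i _ => rfl, ?_⟩
  · intro i j
    dsimp only
    split_ifs with h
    · rw [h]; exact degree_X_pow_le _
    · simp
  · intro i hi _
    rw [Finset.sum_eq_single (t + 1)]
    · have h : (t + 1) ∣ i - (t + 1) ↔ (t + 1) ∣ i := by
        conv_rhs => rw [← Nat.sub_add_cancel hi]
        exact Nat.dvd_add_self_right.symm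
      simp only [h, if_true]
      split_ifs with h1
      · rw [← pow_add]; congr 1; omega
      · simp
    · intro j _ hj
      simp [hj]
    · intro h
      simp at h
  · intro b hb
    obtain ⟨hbd, g, hg, hrec⟩ := hb
    have hlt : ∀ m : Fin (k - 1), ((m : ℕ) + 1) * (t + 1) < N := by
      intro m
      have := m.2
      have h2 : (m : ℕ) + 1 < 2 * k := by omega
      rw [hN]
      nlinarith
    have key : ∀ m : Fin (k - 1), ∃ i : Fin N, m * (t + 1) < (i : ℕ) ∧
        (i : ℕ) ≤ (m + 1) * (t + 1) ∧
        (if (t + 1) ∣ (i : ℕ) then X ^ (i : ℕ) else 0 : Polynomial ℤ).coeff i ≠ (b i).coeff i := by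
      intro m
      by_contra! hc
      have hm := hlt m
      set n := ((m : ℕ) + 1) * (t + 1) with hn
      have hn' : n = m * (t + 1) + t + 1 := by rw [hn]; ring
      have h1 := hc ⟨n, hm⟩ (by simp; omega) le_rfl
      simp only [hn, dvd_mul_left, if_true, coeff_X_pow_self] at h1
      rw [← hn, hrec n (by omega) hm, finsetSum_coeff, Finset.sum_eq_zero] at h1
      · exact one_ne_zero h1
      · intro j hj
        rw [Finset.mem_Icc] at hj
        have h2 := hc ⟨n - j, by omega⟩ (by simp; omega) (by simp)
        have h3 : ¬ (t + 1) ∣ n - j := by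
          intro hd
          have : (t + 1) ∣ j := (Nat.dvd_sub_iff_right (by omega) (Dvd.intro_left _ hn.symm)).1 hd
          have := Nat.le_of_dvd (by omega) this
          omega
        simp only [h3, if_false, coeff_zero] at h2
        have h4 := coeff_mul_add_eq_of_natDegree_le (natDegree_le_of_degree_le (hg n j))
          (natDegree_le_of_degree_le (hbd (n - j) (by omega)))
        rw [← h2, mul_zero, show j + (n - j) = n by omega] at h4
        exact h4
    choose e he1 he2 he3 using key
    have hmono : ∀ x y : Fin (k - 1), x < y → (e x : ℕ) < e y := by
      intro x y hxy
      have h1 := he2 x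
      have h2 := he1 y
      have : (x : ℕ) + 1 ≤ y := hxy
      have := Nat.mul_le_mul_right (t + 1) this
      omega
    set A : Matrix (Fin N) (Fin N) ℚ := (Matrix.of fun i j : Fin N =>
      (((if (t + 1) ∣ (i : ℕ) then X ^ (i : ℕ) else 0 : Polynomial ℤ).coeff (j : ℕ) : ℤ) : ℚ)) -
            (Matrix.of fun i j : Fin N => ((b i).coeff (j : ℕ) : ℚ)) with hA
    have hdet : (A.submatrix e e).det ≠ 0 := by
      rw [Matrix.det_of_lowerTriangular]
      · rw [Finset.prod_ne_zero_iff]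
        intro m _
        simp only [hA, Matrix.submatrix_apply, Matrix.sub_apply, Matrix.of_apply]
        rw [sub_ne_zero]
        exact_mod_cast he3 m
      · intro x y hxy
        have hxy : (e x : ℕ) < e y := hmono x y hxy
        simp only [hA, Matrix.submatrix_apply, Matrix.sub_apply, Matrix.of_apply]
        rw [coeff_eq_zero_of_degree_lt ((hadeg _).trans_lt (by exact_mod_cast hxy)),
          coeff_eq_zero_of_degree_lt ((hbd _ (e x).2).trans_lt (by exact_mod_cast hxy))]
        simp
    have hr : k - 1 ≤ A.rank := by
      have h1 := Matrix.rank_of_isUnit (A.submatrix e e)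
        ((Matrix.isUnit_iff_isUnit_det _).2 hdet.isUnit)
      rw [Fintype.card_fin] at h1
      rw [← h1]
      exact Matrix.rank_submatrix_le _ _ _
    have hr' : (k : ℝ) ≤ A.rank + 1 := by
      exact_mod_cast (by omega : k ≤ A.rank + 1)
    have : (N : ℝ) / (2 * ((t : ℝ) + 1)) = k := by
      rw [hN]; push_cast; field_simp
    rw [this]
    linarith
end

section
/- Bivariate evaluation matrices have displacement rank 2 with respect to higher-order shift operators: In the bivariate setup, the matrix C = D_Y^{-1}·D_X^{-1}·A − D_Y^{-1}·A·Z − D_X^{-1}·A·Z^d + A·Z^{d+1} satisfies C[k,0] = 1/(x_k·y_k) and C[k,d] = −x_k^{d−1}/y_k for every k, and C[k,c] = 0 for every column index c ∉ {0, d}. In particular, rank(C) ≤ 2. -/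
open Matrix

theorem mul_shift_pow {F : Type*} [Field F] {N : ℕ} (A Z : Matrix (Fin N) (Fin N) F)
    (hZ : ∀ i j, Z i j = if (j : ℕ) = (i : ℕ) + 1 then 1 else 0) (a : Fin N → ℕ → F)
    (hA : ∀ k c, A k c = a k (c : ℕ)) (s : ℕ) :
    ∀ k c, (A * Z ^ s) k c = if s ≤ (c : ℕ) then a k ((c : ℕ) - s) else 0 := by
  induction s with
  | zero => intro k c; simp [hA]
  | succ s ih =>
    intro k c
    rw [pow_succ, ← Matrix.mul_assoc, Matrix.mul_apply]
    simp only [hZ, ih]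
    by_cases hc : (c : ℕ) = 0
    · have : ¬ (s + 1 ≤ (c : ℕ)) := by omega
      rw [if_neg this]
      apply Finset.sum_eq_zero
      intro i _
      rw [if_neg (by omega : ¬ ((c : ℕ) = (i : ℕ) + 1)), mul_zero]
    · have hlt : (c : ℕ) - 1 < N := by omega
      rw [Finset.sum_eq_single (⟨(c : ℕ) - 1, hlt⟩ : Fin N)]
      · have h1 : (c : ℕ) = (c : ℕ) - 1 + 1 := by omega
        rw [if_pos h1, mul_one]
        have h2 : (c : ℕ) - 1 - s = (c : ℕ) - (s + 1) := by omega
        have h3 : (s ≤ (c : ℕ) - 1) ↔ (s + 1 ≤ (c : ℕ)) := by omega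
        simp only [h2, h3]
      · intro i _ hi
        have hne : ¬ ((c : ℕ) = (i : ℕ) + 1) := by
          intro h
          apply hi
          ext
          simp
          omega
        rw [if_neg hne, mul_zero]
      · simp

/-- **Bivariate evaluation matrices have displacement rank 2 with respect to higher-order shift
operators.** With `N = d²`, `A[k, j₂·d + j₁] = y_k^{j₂} · x_k^{j₁}`, `Z` the upper shift, and
`CM = D_Y⁻¹·D_X⁻¹·A − D_Y⁻¹·A·Z − D_X⁻¹·A·Z^d + A·Z^{d+1}`, the matrix `CM` has
`CM[k,0] = 1/(x_k y_k)`, `CM[k,d] = −x_k^{d−1}/y_k`, zero in all other columns, and hence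
rank at most 2. -/
theorem bivariate_displacement_rank_two
    (F : Type*) [Field F] (d : ℕ) (hd : 1 ≤ d)
    (x y : Fin (d ^ 2) → F) (hx : ∀ k, x k ≠ 0) (hy : ∀ k, y k ≠ 0)
    (A : Matrix (Fin (d ^ 2)) (Fin (d ^ 2)) F)
    (hA : ∀ k c, A k c = y k ^ ((c : ℕ) / d) * x k ^ ((c : ℕ) % d))
    (Z : Matrix (Fin (d ^ 2)) (Fin (d ^ 2)) F)
    (hZ : ∀ i j, Z i j = if (j : ℕ) = (i : ℕ) + 1 then 1 else 0)
    (CM : Matrix (Fin (d ^ 2)) (Fin (d ^ 2)) F)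
    (hCM : CM = diagonal (fun k => (y k)⁻¹) * diagonal (fun k => (x k)⁻¹) * A
      - diagonal (fun k => (y k)⁻¹) * A * Z
      - diagonal (fun k => (x k)⁻¹) * A * Z ^ d
      + A * Z ^ (d + 1)) :
    (∀ k, CM k ⟨0, pow_pos hd 2⟩ = (x k * y k)⁻¹) ∧
    (∀ (hdN : d < d ^ 2) (k : Fin (d ^ 2)), CM k ⟨d, hdN⟩ = -(x k ^ (d - 1) / y k)) ∧
    (∀ (k c : Fin (d ^ 2)), (c : ℕ) ≠ 0 → (c : ℕ) ≠ d → CM k c = 0) ∧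
    CM.rank ≤ 2 := by
  obtain ⟨a, ha⟩ : ∃ a : Fin (d ^ 2) → ℕ → F,
      ∀ k n, a k n = y k ^ (n / d) * x k ^ (n % d) := ⟨_, fun _ _ => rfl⟩
  have hA' : ∀ k c, A k c = a k (c : ℕ) := fun k c => by rw [hA, ha]
  have hS := mul_shift_pow A Z hZ a hA'
  have hyd : ∀ k n, a k (n + d) = y k * a k n := by
    intro k n
    rw [ha, ha, Nat.add_div_right _ hd, Nat.add_mod_right, pow_succ]
    ring
  have hxs : ∀ k n, (n + 1) % d ≠ 0 → a k (n + 1) = x k * a k n := by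
    intro k n h
    have h0 : ¬ d ∣ n + 1 := fun h' => h (Nat.mod_eq_zero_of_dvd h')
    have h1 : (n + 1) / d = n / d := by rw [Nat.succ_div, if_neg h0, add_zero]
    have h2 : (n + 1) % d = n % d + 1 := by
      have e1 := Nat.div_add_mod (n + 1) d
      have e2 := Nat.div_add_mod n d
      rw [h1] at e1
      omega
    rw [ha, ha, h1, h2, pow_succ]
    ring
  have hC : ∀ k c, CM k c = (y k)⁻¹ * (x k)⁻¹ * a k (c : ℕ)
      - (y k)⁻¹ * (if 1 ≤ (c : ℕ) then a k ((c : ℕ) - 1) else 0)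
      - (x k)⁻¹ * (if d ≤ (c : ℕ) then a k ((c : ℕ) - d) else 0)
      + (if d + 1 ≤ (c : ℕ) then a k ((c : ℕ) - (d + 1)) else 0) := by
    intro k c
    have h1 := hS 1 k c
    rw [pow_one] at h1
    rw [hCM, ← hS d, ← hS (d + 1), ← h1, ← hA']
    simp only [Matrix.mul_assoc, Matrix.add_apply, Matrix.sub_apply, Matrix.diagonal_mul]
    ring
  have a0 : ∀ k, a k 0 = 1 := fun k => by simp [ha]
  have hzero : ∀ (k c : Fin (d ^ 2)), (c : ℕ) ≠ 0 → (c : ℕ) ≠ d → CM k c = 0 := by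
    intro k c h0 h1
    have hxk := hx k
    have hyk := hy k
    rw [hC, if_pos (by omega : 1 ≤ (c : ℕ))]
    by_cases hlt : (c : ℕ) < d
    · rw [if_neg (by omega), if_neg (by omega)]
      obtain ⟨n, hn⟩ : ∃ n, (c : ℕ) = n + 1 := ⟨(c : ℕ) - 1, by omega⟩
      rw [hn] at hlt ⊢
      rw [hxs k n (by rw [Nat.mod_eq_of_lt hlt]; omega), Nat.add_sub_cancel]
      field_simp
      ring
    · rw [if_pos (by omega), if_pos (by omega)]
      obtain ⟨n, hn⟩ : ∃ n, (c : ℕ) = n + 1 + d := ⟨(c : ℕ) - 1 - d, by omega⟩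
      rw [hn, hyd, show n + 1 + d - 1 = n + d by omega, hyd,
        show n + 1 + d - d = n + 1 by omega, show n + 1 + d - (d + 1) = n by omega]
      field_simp
      ring
  refine ⟨?_, ?_, hzero, ?_⟩
  · intro k
    rw [hC]
    have : ¬ d ≤ 0 := by omega
    simp [a0, this, mul_comm]
  · intro hdN k
    have hxk := hx k
    have hyk := hy k
    rw [hC]
    have e1 : a k d = y k := by
      have := hyd k 0
      rwa [zero_add, a0, mul_one] at this
    have e2 : a k (d - 1) = x k ^ (d - 1) := by
      rw [ha, Nat.div_eq_of_lt (by omega), Nat.mod_eq_of_lt (by omega), pow_zero, one_mul]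
    simp only [hd, le_refl, if_true, e1, e2, Nat.sub_self, a0]
    rw [if_neg (by omega)]
    field_simp
    ring
  · classical
    let w : Fin (d ^ 2) → F := fun c => if (c : ℕ) = 0 ∨ (c : ℕ) = d then 1 else 0
    have hfac : CM = CM * diagonal w := by
      ext k c
      rw [Matrix.mul_diagonal]
      by_cases h : (c : ℕ) = 0 ∨ (c : ℕ) = d
      · simp [w, h]
      · push Not at h
        rw [hzero k c h.1 h.2, zero_mul]
    rw [hfac]
    refine (Matrix.rank_mul_le_right _ _).trans ?_
    rw [Matrix.rank_diagonal]
    let f : {i // w i ≠ 0} → ({0, d} : Finset ℕ) := fun i => ⟨(i.1 : ℕ), by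
      have := i.2
      by_contra h
      apply this
      simp only [Finset.mem_insert, Finset.mem_singleton] at h
      simp [w, h]⟩
    have hf : Function.Injective f := by
      intro i j hij
      have : ((f i : ℕ)) = f j := by rw [hij]
      exact Subtype.ext (Fin.ext this)
    have := Fintype.card_le_of_injective f hf
    rw [Fintype.card_coe] at this
    exact this.trans Finset.card_le_two
end

section
/- Bivariate evaluation matrices have displacement rank at most d with respect to the shift: In the bivariate setup, the matrix B = D_X^{-1}·A − A·Z satisfies B[k,c] = 0 for every column index c that is not divisible by d. In particular, rank(B) ≤ d. -/
open Matrix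

/-- **Bivariate evaluation matrices have displacement rank at most `d` with respect to the
shift.** With `N = d²`, `A[k, j₂·d + j₁] = y_k^{j₂} · x_k^{j₁}`, `Z` the upper shift, and
`B = D_X⁻¹·A − A·Z`, every column of `B` whose index is not divisible by `d` is zero; in
particular `rank B ≤ d`. -/
theorem bivariate_displacement_rank_d
    (F : Type*) [Field F] (d : ℕ) (hd : 1 ≤ d)
    (x y : Fin (d ^ 2) → F) (hx : ∀ k, x k ≠ 0) (hy : ∀ k, y k ≠ 0)
    (A : Matrix (Fin (d ^ 2)) (Fin (d ^ 2)) F)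
    (hA : ∀ k c, A k c = y k ^ ((c : ℕ) / d) * x k ^ ((c : ℕ) % d))
    (Z : Matrix (Fin (d ^ 2)) (Fin (d ^ 2)) F)
    (hZ : ∀ i j, Z i j = if (j : ℕ) = (i : ℕ) + 1 then 1 else 0)
    (B : Matrix (Fin (d ^ 2)) (Fin (d ^ 2)) F)
    (hB : B = diagonal (fun k => (x k)⁻¹) * A - A * Z) :
    (∀ (k c : Fin (d ^ 2)), ¬ d ∣ (c : ℕ) → B k c = 0) ∧ B.rank ≤ d := by
  have h1 : ∀ (k c : Fin (d ^ 2)), ¬ d ∣ (c : ℕ) → B k c = 0 := by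
    intro k c hc
    obtain ⟨c, hcN⟩ := c
    simp only at hc
    have hc0 : c ≠ 0 := by
      rintro rfl
      exact hc (dvd_zero d)
    obtain ⟨e, rfl⟩ := Nat.exists_eq_succ_of_ne_zero hc0
    have hAZ : (A * Z) k ⟨e.succ, hcN⟩ = A k ⟨e, by omega⟩ := by
      rw [Matrix.mul_apply, Finset.sum_eq_single (⟨e, by omega⟩ : Fin (d ^ 2))]
      · simp [hZ]
      · intro b _ hb
        have hb' : ¬ (e.succ = (b : ℕ) + 1) := by
          intro h
          apply hb
          ext
          simp only
          omega
        rw [hZ]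
        simp only [if_neg hb', mul_zero]
      · intro h
        exact absurd (Finset.mem_univ _) h
    have hdiv : e.succ / d = e / d := by
      rw [Nat.succ_div, if_neg hc, add_zero]
    have hmod : e.succ % d = e % d + 1 := by
      have a1 := Nat.div_add_mod e.succ d
      have a2 := Nat.div_add_mod e d
      rw [hdiv] at a1
      omega
    rw [hB, Matrix.sub_apply, hAZ, Matrix.diagonal_mul, hA, hA]
    simp only [hdiv, hmod, pow_succ]
    have := hx k
    field_simp
    ring
  refine ⟨h1, ?_⟩
  have hlt : ∀ j : Fin d, (j : ℕ) * d < d ^ 2 := by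
    intro j
    rw [pow_two]
    exact Nat.mul_lt_mul_of_pos_right j.2 hd
  let P : Matrix (Fin (d ^ 2)) (Fin d) F := fun k j => B k ⟨j * d, hlt j⟩
  let Q : Matrix (Fin d) (Fin (d ^ 2)) F := fun j c => if (c : ℕ) = j * d then 1 else 0
  have hPQ : B = P * Q := by
    ext k c
    rw [Matrix.mul_apply]
    by_cases hc : d ∣ (c : ℕ)
    · obtain ⟨m, hm⟩ := hc
      have hmd : m < d := by
        have := c.2
        rw [hm, pow_two] at this
        exact Nat.lt_of_mul_lt_mul_left this
      rw [Finset.sum_eq_single (⟨m, hmd⟩ : Fin d)]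
      · have : (⟨m * d, hlt ⟨m, hmd⟩⟩ : Fin (d ^ 2)) = c := by
          ext
          simp only [hm, mul_comm]
        have hcm : (c : ℕ) = m * d := by rw [hm, mul_comm]
        simp only [P, Q, this, if_pos hcm, mul_one]
      · intro b _ hb
        have : ¬ ((c : ℕ) = b * d) := by
          intro h
          apply hb
          ext
          rw [hm, mul_comm] at h
          exact (Nat.eq_of_mul_eq_mul_right hd h).symm
        simp only [Q, if_neg this, mul_zero]
      · intro h
        exact absurd (Finset.mem_univ _) h
    · rw [h1 k c hc]
      symm
      apply Finset.sum_eq_zero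
      intro j _
      have : ¬ ((c : ℕ) = j * d) := fun h => hc (h ▸ dvd_mul_left d _)
      simp only [Q, if_neg this, mul_zero]
  rw [hPQ]
  exact (Matrix.rank_mul_le_left P Q).trans (by simpa using Matrix.rank_le_width P)
end

section
/- Krylov matrices of triangular banded matrices satisfy a bounded-width modular recurrence: Let F be a field, Δ ≥ 0, let M be an n×n lower-triangular (Δ+1)-band matrix over F (i.e., M[i,j] = 0 unless i−Δ ≤ j ≤ i), and let y ∈ F^n, N ≥ 1. Define f_i(X) = Σ_{j=0}^{N−1} (M^j·y)_i·X^j, the polynomial of the i-th row of the Krylov matrix K(M,y). Then for every 0 ≤ i < n, (1 − M[i,i]·X)·f_i(X) ≡ Σ_{j=1}^{min(i,Δ)} M[i,i−j]·X·f_{i−j}(X) + y_i (mod X^N). (This exhibits K(M,y) as satisfying a modular recurrence of width Δ and degree (0,1).) -/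
open Polynomial Matrix

lemma band_sum_aux {R : Type*} [AddCommMonoid R] {n : ℕ} (Δ : ℕ) (g : Fin n → R) (i : Fin n)
    (hg : ∀ j : Fin n, ((j : ℕ) + Δ < (i : ℕ) ∨ (i : ℕ) < (j : ℕ)) → g j = 0) :
    ∑ k, g k = g i + ∑ j ∈ Finset.Icc 1 (min (i : ℕ) Δ),
      g ⟨(i : ℕ) - j, lt_of_le_of_lt (Nat.sub_le _ _) i.isLt⟩ := by
  have h1 : ∑ j ∈ insert 0 (Finset.Icc 1 (min (i : ℕ) Δ)),
      g ⟨(i : ℕ) - j, lt_of_le_of_lt (Nat.sub_le _ _) i.isLt⟩ = g i +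
      ∑ j ∈ Finset.Icc 1 (min (i : ℕ) Δ),
      g ⟨(i : ℕ) - j, lt_of_le_of_lt (Nat.sub_le _ _) i.isLt⟩ := by
    rw [Finset.sum_insert (by simp)]
    rfl
  rw [← h1]
  symm
  rw [← Finset.sum_image (f := g)
    (g := fun j : ℕ => (⟨(i : ℕ) - j, lt_of_le_of_lt (Nat.sub_le _ _) i.isLt⟩ : Fin n))]
  · apply Finset.sum_subset (Finset.subset_univ _)
    intro k _ hk
    apply hg
    by_contra hcon
    apply hk
    rw [Finset.mem_image]
    refine ⟨(i : ℕ) - k, ?_, ?_⟩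
    · simp only [Finset.mem_insert, Finset.mem_Icc]
      omega
    · ext
      simp only
      omega
  · intro a ha b hb hab
    simp only [Finset.coe_insert, Finset.coe_Icc, Set.mem_insert_iff, Set.mem_Icc] at ha hb
    simp only [Fin.mk.injEq] at hab
    omega


/-- **Krylov matrices of triangular banded matrices satisfy a bounded-width modular
recurrence.** If `M` is lower triangular and `(Δ+1)`-band and
`fᵢ(X) = ∑_{j<N} (M^j·y)ᵢ · X^j` are the row polynomials of the Krylov matrix `K(M,y)`, then
`(1 − M[i,i]·X)·fᵢ ≡ ∑_{j=1}^{min(i,Δ)} M[i,i−j]·X·f_{i−j} + yᵢ (mod X^N)`. -/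
theorem krylov_banded_recurrence
    (F : Type*) [Field F] (n N Δ : ℕ) (hN : 1 ≤ N)
    (M : Matrix (Fin n) (Fin n) F)
    (hband : ∀ i j : Fin n, ((j : ℕ) + Δ < (i : ℕ) ∨ (i : ℕ) < (j : ℕ)) → M i j = 0)
    (y : Fin n → F)
    (f : Fin n → Polynomial F)
    (hf : ∀ i, f i = ∑ j ∈ Finset.range N, Polynomial.C ((M ^ j).mulVec y i) * X ^ j) :
    ∀ i : Fin n,
      (X : Polynomial F) ^ N ∣
        ((1 - Polynomial.C (M i i) * X) * f i -
          ((∑ j ∈ Finset.Icc 1 (min (i : ℕ) Δ),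
              Polynomial.C (M i ⟨(i : ℕ) - j, lt_of_le_of_lt (Nat.sub_le _ _) i.isLt⟩) * X *
                f ⟨(i : ℕ) - j, lt_of_le_of_lt (Nat.sub_le _ _) i.isLt⟩) +
            Polynomial.C (y i))) := by
  intro i
  have hs := band_sum_aux Δ (fun k => Polynomial.C (M i k) * X * f k) i (by
    intro j hj
    simp [hband i j hj])
  have hk : ∑ k, Polynomial.C (M i k) * X * f k =
      ∑ j ∈ Finset.range N, Polynomial.C ((M ^ (j + 1)).mulVec y i) * X ^ (j + 1) := by
    simp_rw [hf, Finset.mul_sum]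
    rw [Finset.sum_comm]
    refine Finset.sum_congr rfl fun j _ => ?_
    rw [pow_succ' M, ← Matrix.mulVec_mulVec]
    generalize (M ^ j).mulVec y = v
    simp only [Matrix.mulVec, dotProduct, map_sum, map_mul, Finset.sum_mul]
    refine Finset.sum_congr rfl fun k _ => ?_
    ring
  have ht := Finset.sum_range_succ (fun j => Polynomial.C ((M ^ j).mulVec y i) * X ^ j) N
  rw [Finset.sum_range_succ', ← hk, ← hf, hs] at ht
  simp only [pow_zero, Matrix.one_mulVec, mul_one] at ht
  refine ⟨-Polynomial.C ((M ^ N).mulVec y i), ?_⟩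
  linear_combination -ht
end

section
/- Existence and rigidity of the banded similarity recurrence: Let F be a field and M an N×N upper-triangular matrix over F with diagonal entries λ_i = M[i,i] and characteristic polynomial c_M(X) = ∏_{k=0}^{N−1}(X − λ_k). (1) For every choice of scalars d_0,…,d_{N−1} ∈ F there is a unique family of polynomials a_0,…,a_{N−1} ∈ F[X], each of degree < N, satisfying the M-recurrence with error coefficients d. (2) For any such family, the coefficient matrix A satisfies M·A = A·F_{c_M}. In particular, if M is additionally Δ-band (M[i,j] = 0 for j > i+Δ−1), then each a_i is expressed by the recurrence in terms of a_{i+1},…,a_{i+Δ−1} only, so A has recurrence width Δ−1. -/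
open Polynomial Matrix

/-- The coefficient matrix of a family of polynomials: `A[i,j]` is the coefficient of `X^j`
in `aᵢ`. -/
noncomputable def coeffMatrix {F : Type*} [Field F] {N : ℕ} (a : Fin N → Polynomial F) :
    Matrix (Fin N) (Fin N) F :=
  Matrix.of fun i j => (a i).coeff (j : ℕ)

/-- The product `∏ₖ (X − M[k,k])`, which is the characteristic polynomial of an
upper-triangular matrix `M`. -/
noncomputable def charProd {F : Type*} [Field F] {N : ℕ} (M : Matrix (Fin N) (Fin N) F) :
    Polynomial F :=
  ∏ k : Fin N, (X - Polynomial.C (M k k))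

/-- The companion-form matrix `F_c` of a monic polynomial `c` of degree `N`
(`c(X) = X^N − ∑ⱼ cⱼ Xʲ`): superdiagonal ones and last row `cⱼ = −(coeff of Xʲ in c)`. -/
noncomputable def companionForm {F : Type*} [Field F] {N : ℕ} (c : Polynomial F) :
    Matrix (Fin N) (Fin N) F :=
  Matrix.of fun i j =>
    if (i : ℕ) = N - 1 then -(c.coeff (j : ℕ))
    else if (j : ℕ) = (i : ℕ) + 1 then 1 else 0

/-- The family `a` satisfies the `M`-recurrence with error coefficients `d`:
`(X − λᵢ)·aᵢ = ∑_{j>i} M[i,j]·aⱼ + dᵢ·c_M`. -/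
noncomputable def SatisfiesMRec {F : Type*} [Field F] {N : ℕ} (M : Matrix (Fin N) (Fin N) F)
    (d : Fin N → F) (a : Fin N → Polynomial F) : Prop :=
  ∀ i : Fin N,
    (X - Polynomial.C (M i i)) * a i =
      (∑ j ∈ Finset.univ.filter fun j : Fin N => i < j, Polynomial.C (M i j) * a j) +
        Polynomial.C (d i) * charProd M

theorem charProd_monic' {F : Type*} [Field F] {N : ℕ} (M : Matrix (Fin N) (Fin N) F) :
    (charProd M).Monic := monic_prod_of_monic _ _ fun k _ => monic_X_sub_C _

theorem charProd_natDegree {F : Type*} [Field F] {N : ℕ} (M : Matrix (Fin N) (Fin N) F) :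
    (charProd M).natDegree = N := by
  unfold charProd
  rw [natDegree_prod_of_monic _ _ fun k _ => monic_X_sub_C _]
  simp

theorem degC_mul_le {F : Type*} [Field F] (c : F) (p : Polynomial F) :
    (C c * p).degree ≤ p.degree := by
  by_cases hc : c = 0
  · simp [hc]
  · rw [degree_mul, degree_C hc, zero_add]

theorem mrec_unique {F : Type*} [Field F] {N : ℕ} (M : Matrix (Fin N) (Fin N) F)
    (d : Fin N → F) (a b : Fin N → Polynomial F)
    (ha : SatisfiesMRec M d a) (hb : SatisfiesMRec M d b) : a = b := by
  have key : ∀ n : ℕ, ∀ i : Fin N, N - (i : ℕ) = n → a i = b i := by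
    intro n
    induction n using Nat.strong_induction_on with
    | _ n ih =>
      intro i hi
      apply mul_left_cancel₀ (X_sub_C_ne_zero (M i i))
      rw [ha i, hb i]
      congr 1
      refine Finset.sum_congr rfl fun j hj => ?_
      have hij : i < j := (Finset.mem_filter.mp hj).2
      rw [ih (N - j) (by have := j.2; omega) j rfl]
  exact funext fun i => key _ i rfl

theorem mrec_exists {F : Type*} [Field F] {N : ℕ} (M : Matrix (Fin N) (Fin N) F)
    (d : Fin N → F) : ∃ a : Fin N → Polynomial F,
        (∀ i, (a i).degree < (N : WithBot ℕ)) ∧ SatisfiesMRec M d a := by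
  have key : ∀ m : ℕ, m ≤ N → ∃ a : Fin N → Polynomial F, ∀ i : Fin N, N - m ≤ (i : ℕ) →
      (a i).degree < (N : WithBot ℕ) ∧
      (∏ k ∈ Finset.univ.filter (fun k : Fin N => k < i), (X - C (M k k))) ∣ a i ∧
      (X - Polynomial.C (M i i)) * a i =
      (∑ j ∈ Finset.univ.filter fun j : Fin N => i < j, Polynomial.C (M i j) * a j) +
        Polynomial.C (d i) * charProd M := by
    intro m
    induction m with
    | zero =>
      intro _
      exact ⟨0, fun i hi => by have := i.2; omega⟩
    | succ m ih =>
      intro hm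
      obtain ⟨a, ha⟩ := ih (by omega)
      obtain ⟨i0, hi0⟩ : ∃ i0 : Fin N, (i0 : ℕ) = N - (m + 1) := ⟨⟨N - (m+1), by omega⟩, rfl⟩
      set R := (∑ j ∈ Finset.univ.filter fun j : Fin N => i0 < j, Polynomial.C (M i0 j) * a j) +
        Polynomial.C (d i0) * charProd M with hR
      have hins : (∏ k ∈ Finset.univ.filter (fun k : Fin N => k ≤ i0), (X - C (M k k))) =
          (X - C (M i0 i0)) *
            ∏ k ∈ Finset.univ.filter (fun k : Fin N => k < i0), (X - C (M k k)) := by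
        rw [← Finset.prod_insert (f := fun k => X - C (M k k)) (by simp)]
        congr 1
        ext k
        simp [le_iff_eq_or_lt]
      have hdvd : (∏ k ∈ Finset.univ.filter (fun k : Fin N => k ≤ i0), (X - C (M k k))) ∣ R := by
        refine dvd_add (Finset.dvd_sum fun j hj => ?_) ?_
        · have hij : i0 < j := (Finset.mem_filter.mp hj).2
          refine Dvd.dvd.mul_left (dvd_trans ?_ (ha j (by
            have : (i0 : ℕ) < j := hij
            omega)).2.1) _
          refine Finset.prod_dvd_prod_of_subset _ _ _ fun k hk => ?_
          simp only [Finset.mem_filter, Finset.mem_univ, true_and] at hk ⊢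
          exact lt_of_le_of_lt hk hij
        · exact Dvd.dvd.mul_left
            (Finset.prod_dvd_prod_of_subset _ _ _ (Finset.filter_subset _ _)) _
      obtain ⟨q, hq⟩ := hdvd
      rw [hins, mul_assoc] at hq
      have hRdeg : R.degree ≤ (N : WithBot ℕ) := by
        refine degree_add_le_of_degree_le ((degree_sum_le _ _).trans
          (Finset.sup_le fun j hj => ?_)) ?_
        · have hij : i0 < j := (Finset.mem_filter.mp hj).2
          have h1 := (ha j (by
            have : (i0 : ℕ) < j := hij
            omega)).1
          exact (degC_mul_le _ _).trans h1.le
        · refine (degC_mul_le _ _).trans ?_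
          exact degree_le_of_natDegree_le (charProd_natDegree M).le
      set p := (∏ k ∈ Finset.univ.filter (fun k : Fin N => k < i0), (X - C (M k k))) * q with hp
      have hpdeg : p.degree < (N : WithBot ℕ) := by
        by_cases hp0 : p = 0
        · rw [hp0, degree_zero]
          exact WithBot.bot_lt_coe N
        · rw [hq, degree_mul, degree_X_sub_C, degree_eq_natDegree hp0] at hRdeg
          rw [degree_eq_natDegree hp0]
          have : 1 + p.natDegree ≤ N := by exact_mod_cast hRdeg
          exact_mod_cast (by omega : p.natDegree < N)
      refine ⟨Function.update a i0 p, fun i hi => ?_⟩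
      have hsum : (∑ j ∈ Finset.univ.filter fun j : Fin N => i < j,
            Polynomial.C (M i j) * Function.update a i0 p j) =
          ∑ j ∈ Finset.univ.filter fun j : Fin N => i < j, Polynomial.C (M i j) * a j := by
        refine Finset.sum_congr rfl fun j hj => ?_
        have hij : (i : ℕ) < j := (Finset.mem_filter.mp hj).2
        rw [Function.update_of_ne]
        rintro rfl
        omega
      rw [hsum]
      by_cases h : i = i0
      · subst h
        rw [Function.update_self]
        exact ⟨hpdeg, Dvd.intro _ rfl, hq.symm⟩
      · rw [Function.update_of_ne h]
        have : (i : ℕ) ≠ i0 := fun h' => h (Fin.ext h')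
        exact ha i (by omega)
  obtain ⟨a, ha⟩ := key N le_rfl
  exact ⟨a, fun i => (ha i (by omega)).1, fun i => (ha i (by omega)).2.2⟩

theorem mrec_similarity {F : Type*} [Field F] {N : ℕ} (M : Matrix (Fin N) (Fin N) F)
    (hupper : ∀ i j : Fin N, j < i → M i j = 0) (d : Fin N → F) (a : Fin N → Polynomial F)
    (hdeg : ∀ i, (a i).degree < (N : WithBot ℕ)) (ha : SatisfiesMRec M d a) :
    M * coeffMatrix a = coeffMatrix a * companionForm (charProd M) := by
  ext i j
  have hsum : ∑ k, C (M i k) * a k = X * a i - C (d i) * charProd M := by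
    have h1 : ∑ k, C (M i k) * a k = C (M i i) * a i +
        ∑ k ∈ Finset.univ.filter (fun k : Fin N => i < k), C (M i k) * a k := by
      rw [← Finset.sum_insert (f := fun k => C (M i k) * a k) (by simp)]
      symm
      refine Finset.sum_subset (Finset.subset_univ _) fun k _ hk => ?_
      simp only [Finset.mem_insert, Finset.mem_filter, Finset.mem_univ, true_and, not_or,
        not_lt] at hk
      rw [hupper i k (lt_of_le_of_ne hk.2 hk.1)]
      simp
    rw [h1]
    linear_combination -(ha i)
  obtain ⟨n, rfl⟩ : ∃ n, N = n + 1 := ⟨N - 1, by have := i.2; omega⟩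
  have hco : ∀ m, ∑ k, M i k * (a k).coeff m =
      (X * a i).coeff m - d i * (charProd M).coeff m := by
    intro m
    have := congrArg (fun p => coeff p m) hsum
    simpa [finsetSum_coeff] using this
  have hd : d i = (a i).coeff n := by
    have h := hco (n + 1)
    have hc : (charProd M).coeff (n + 1) = 1 := by
      have := charProd_monic' M
      rw [Monic, leadingCoeff, charProd_natDegree] at this
      exact this
    rw [Finset.sum_eq_zero (fun k _ => by
      rw [coeff_eq_zero_of_degree_lt (hdeg k), mul_zero]), hc, coeff_X_mul] at h
    linear_combination h
  simp only [Matrix.mul_apply, coeffMatrix, companionForm, Matrix.of_apply]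
  rw [hco, hd, Fin.sum_univ_castSucc]
  have hne : ∀ k : Fin n, (k : ℕ) ≠ n := fun k => k.2.ne
  simp only [Fin.val_castSucc, Fin.val_last, Nat.add_sub_cancel, if_true, hne, if_false]
  have h2 : (X * a i).coeff j = ∑ k : Fin n, (a i).coeff k * (if (j : ℕ) = k + 1 then 1 else 0) := by
    refine Fin.cases ?_ (fun j' => ?_) j
    · simp
    · rw [Fin.val_succ, coeff_X_mul, Finset.sum_eq_single j']
      · simp
      · intro b _ hb
        rw [if_neg, mul_zero]
        intro h
        exact hb (Fin.ext (by omega))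
      · simp
  rw [h2]
  ring

/-- **Existence and rigidity of the banded similarity recurrence.** For an upper-triangular
`M`: (1) for every choice of error coefficients `d` there is a unique degree-`< N` family
satisfying the `M`-recurrence; (2) any such family's coefficient matrix `A` satisfies
`M·A = A·F_{c_M}`; (3) if moreover `M` is `Δ`-band, the recurrence for `aᵢ` involves only
`a_{i+1}, …, a_{i+Δ−1}`. -/
theorem banded_similarity_recurrence
    (F : Type*) [Field F] (N : ℕ)
    (M : Matrix (Fin N) (Fin N) F)
    (hupper : ∀ i j : Fin N, j < i → M i j = 0) :
    (∀ d : Fin N → F, ∃! a : Fin N → Polynomial F,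
        (∀ i, (a i).degree < (N : WithBot ℕ)) ∧ SatisfiesMRec M d a) ∧
    (∀ (d : Fin N → F) (a : Fin N → Polynomial F),
        (∀ i, (a i).degree < (N : WithBot ℕ)) → SatisfiesMRec M d a →
          M * coeffMatrix a = coeffMatrix a * companionForm (charProd M)) ∧
    (∀ (Δ : ℕ) (d : Fin N → F) (a : Fin N → Polynomial F),
        (∀ i j : Fin N, (i : ℕ) + Δ - 1 < (j : ℕ) → M i j = 0) →
        SatisfiesMRec M d a →
        ∀ i : Fin N,
          (X - Polynomial.C (M i i)) * a i =
            (∑ j ∈ Finset.univ.filter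
                fun j : Fin N => i < j ∧ (j : ℕ) ≤ (i : ℕ) + Δ - 1,
              Polynomial.C (M i j) * a j) +
              Polynomial.C (d i) * charProd M) := by
  refine ⟨fun d => ?_, fun d a hdeg ha => mrec_similarity M hupper d a hdeg ha,
    fun Δ d a hband ha i => ?_⟩
  · obtain ⟨a, ha⟩ := mrec_exists M d
    exact ⟨a, ha, fun b hb => mrec_unique M d b a hb.2 ha.2⟩
  · rw [ha i]
    congr 1
    symm
    refine Finset.sum_subset (fun k hk => ?_) fun k hk hk' => ?_
    · simp only [Finset.mem_filter, Finset.mem_univ, true_and] at hk ⊢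
      exact hk.1
    · simp only [Finset.mem_filter, Finset.mem_univ, true_and, not_and, not_le] at hk hk'
      rw [hband i k (hk' hk)]
      simp
end

section
/- Divisibility along the recurrence (triangularity lemma): Let F be a field, M an N×N upper-triangular matrix over F with diagonal entries λ_i = M[i,i], and let a_0,…,a_{N−1} ∈ F[X] satisfy the M-recurrence with error coefficients d for some scalars d_0,…,d_{N−1} ∈ F. Then ∏_{j=0}^{i−1}(X − λ_j) divides a_i(X) for every 0 ≤ i ≤ N−1. -/
open Polynomial Matrix

/-- **Divisibility along the recurrence (triangularity lemma).** If `M` is upper triangular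
and the family `a` satisfies the `M`-recurrence with error coefficients `d`, then
`∏_{j<i} (X − λⱼ)` divides `aᵢ` for every `i`. -/
theorem triangularity_divisibility
    (F : Type*) [Field F] (N : ℕ)
    (M : Matrix (Fin N) (Fin N) F)
    (hupper : ∀ i j : Fin N, j < i → M i j = 0)
    (d : Fin N → F) (a : Fin N → Polynomial F)
    (ha : SatisfiesMRec M d a) :
    ∀ i : Fin N,
      (∏ j ∈ Finset.univ.filter fun j : Fin N => j < i,
        (X - Polynomial.C (M j j))) ∣ a i := by
  intro i
  induction i using WellFoundedGT.induction with
  | ind i ih =>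
    have hne : (X - Polynomial.C (M i i)) ≠ 0 := Polynomial.X_sub_C_ne_zero _
    rw [← mul_dvd_mul_iff_left hne, ha i]
    have hins : (X - Polynomial.C (M i i)) *
        (∏ j ∈ Finset.univ.filter fun j : Fin N => j < i, (X - Polynomial.C (M j j))) =
        ∏ j ∈ insert i (Finset.univ.filter fun j : Fin N => j < i),
          (X - Polynomial.C (M j j)) := by
      rw [Finset.prod_insert (by simp)]
    rw [hins]
    apply dvd_add
    · apply Finset.dvd_sum
      intro k hk
      have hik : i < k := by simpa using hk
      refine Dvd.dvd.mul_left (dvd_trans ?_ (ih k hik)) _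
      apply Finset.prod_dvd_prod_of_subset
      intro j hj
      simp only [Finset.mem_insert, Finset.mem_filter, Finset.mem_univ, true_and] at hj ⊢
      rcases hj with rfl | hj
      · exact hik
      · exact hj.trans hik
    · refine Dvd.dvd.mul_left ?_ _
      exact Finset.prod_dvd_prod_of_subset _ _ _ (Finset.subset_univ _)
end

section
/- Confluent-Vandermonde triangularity equivalences: Let F be a field, λ_0,…,λ_{N−1} ∈ F with multiplicity counters n_i = #{k < i : λ_k = λ_i} and confluent Vandermonde matrix V, and let a_0,…,a_{N−1} ∈ F[X] have degree < N with coefficient matrix A. Then (A·V^T)[i,j] = (hasseDeriv_{n_j} a_i)(λ_j) for all i, j, and the following are equivalent: (a) A·V^T is upper triangular; (b) (hasseDeriv_{n_j} a_i)(λ_j) = 0 for all j < i; (c) ∏_{j<i}(X − λ_j) divides a_i(X) for every i. -/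
open Polynomial Matrix

/-- The multiplicity counter `nᵢ = #{k < i : λ_k = λ_i}`. -/
def multCounter {F : Type*} [DecidableEq F] {N : ℕ} (lam : Fin N → F) (i : Fin N) : ℕ :=
  (Finset.univ.filter fun k : Fin N => k < i ∧ lam k = lam i).card

/-- The confluent Vandermonde matrix of `(λ₀, …, λ_{N−1})`:
`V[i,j] = C(j, nᵢ) · λᵢ^{j − nᵢ}` for `j ≥ nᵢ`, and `0` for `j < nᵢ`. -/
def confluentVandermonde {F : Type*} [Field F] [DecidableEq F] {N : ℕ} (lam : Fin N → F) :
    Matrix (Fin N) (Fin N) F :=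
  Matrix.of fun i j =>
    if multCounter lam i ≤ (j : ℕ) then
      (Nat.choose (j : ℕ) (multCounter lam i) : F) * lam i ^ ((j : ℕ) - multCounter lam i)
    else 0

theorem cvt_step {F : Type*} [Field F] [DecidableEq F] {N : ℕ} (lam : Fin N → F)
    (i : Fin N) (q : Polynomial F) :
    (Polynomial.hasseDeriv (multCounter lam i)
      ((∏ j ∈ Finset.univ.filter (fun j : Fin N => j < i), (X - Polynomial.C (lam j))) * q)).eval
        (lam i) = 0 ↔ (X - Polynomial.C (lam i)) ∣ q := by
  have h1 : (∏ j ∈ Finset.univ.filter (fun j : Fin N => j < i), (X - Polynomial.C (lam j)))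
      = (X - Polynomial.C (lam i)) ^ (multCounter lam i) *
        ∏ j ∈ Finset.univ.filter (fun j : Fin N => j < i ∧ ¬ lam j = lam i),
          (X - Polynomial.C (lam j)) := by
    rw [← Finset.prod_filter_mul_prod_filter_not _ (fun j => lam j = lam i),
      Finset.filter_filter, Finset.filter_filter]
    congr 1
    rw [multCounter]
    apply Finset.prod_eq_pow_card
    intro j hj
    rw [(Finset.mem_filter.1 hj).2.2]
  rw [h1, ← taylor_coeff, mul_assoc, taylor_mul, taylor_pow]
  have h2 : taylor (lam i) (X - Polynomial.C (lam i)) = X := by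
    simp [taylor_apply]
  rw [h2]
  have h3 := coeff_X_pow_mul (taylor (lam i) ((∏ j ∈ Finset.univ.filter
    (fun j : Fin N => j < i ∧ ¬ lam j = lam i), (X - Polynomial.C (lam j))) * q))
    (multCounter lam i) 0
  rw [zero_add] at h3
  rw [h3, taylor_coeff_zero, eval_mul, eval_prod, mul_eq_zero, dvd_iff_isRoot, IsRoot.def,
    or_iff_right]
  rw [Finset.prod_eq_zero_iff]
  rintro ⟨j, hj, h⟩
  simp only [eval_sub, eval_X, eval_C, sub_eq_zero] at h
  exact (Finset.mem_filter.1 hj).2.2 h.symm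

theorem cvt_main {F : Type*} [Field F] [DecidableEq F] {N : ℕ} (lam : Fin N → F)
    (p : Polynomial F) (m : ℕ) (hm : m ≤ N) :
    (∀ j : Fin N, (j : ℕ) < m → (Polynomial.hasseDeriv (multCounter lam j) p).eval (lam j) = 0) ↔
      (∏ j ∈ Finset.univ.filter (fun j : Fin N => (j : ℕ) < m), (X - Polynomial.C (lam j))) ∣ p := by
  induction m with
  | zero => simp
  | succ m ih =>
    have ih := ih (by omega)
    let i : Fin N := ⟨m, hm⟩
    have hs : Finset.univ.filter (fun j : Fin N => (j : ℕ) < m + 1) =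
        insert i (Finset.univ.filter (fun j : Fin N => (j : ℕ) < m)) := by
      ext j
      simp [i, Fin.ext_iff]
      omega
    have hP : (∏ j ∈ Finset.univ.filter (fun j : Fin N => (j : ℕ) < m),
        (X - Polynomial.C (lam j))) ≠ 0 :=
      Finset.prod_ne_zero_iff.2 fun j _ => X_sub_C_ne_zero _
    rw [hs, Finset.prod_insert (by simp [i]), mul_comm]
    have hsplit : (∀ j : Fin N, (j : ℕ) < m + 1 →
        (Polynomial.hasseDeriv (multCounter lam j) p).eval (lam j) = 0) ↔
        (∀ j : Fin N, (j : ℕ) < m →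
          (Polynomial.hasseDeriv (multCounter lam j) p).eval (lam j) = 0) ∧
        (Polynomial.hasseDeriv (multCounter lam i) p).eval (lam i) = 0 := by
      constructor
      · intro h
        exact ⟨fun j hj => h j (by omega), h i (by simp [i])⟩
      · rintro ⟨h, h'⟩ j hj
        rcases Nat.lt_succ_iff_lt_or_eq.1 hj with h0 | h0
        · exact h j h0
        · have : j = i := Fin.ext h0
          rw [this]; exact h'
    rw [hsplit, ih]
    constructor
    · rintro ⟨⟨q, rfl⟩, h⟩
      exact mul_dvd_mul_left _ ((cvt_step lam i q).1 h)
    · intro h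
      obtain ⟨q, rfl⟩ := dvd_of_mul_right_dvd h
      exact ⟨dvd_mul_right _ _, (cvt_step lam i q).2 ((mul_dvd_mul_iff_left hP).1 h)⟩

theorem cvt_entry {F : Type*} [Field F] [DecidableEq F] {N : ℕ} (lam : Fin N → F)
    (a : Fin N → Polynomial F) (hdeg : ∀ i, (a i).degree < (N : WithBot ℕ)) (i j : Fin N) :
    (coeffMatrix a * (confluentVandermonde lam)ᵀ) i j =
        (Polynomial.hasseDeriv (multCounter lam j) (a i)).eval (lam j) := by
  rw [hasseDeriv_apply, sum_over_range' _ (by simp) N, eval_finsetSum, Matrix.mul_apply,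
    ← Fin.sum_univ_eq_sum_range
      (fun k => eval (lam j) (monomial (k - multCounter lam j)
        ((k.choose (multCounter lam j) : F) * (a i).coeff k))) N]
  · refine Finset.sum_congr rfl fun k _ => ?_
    simp only [coeffMatrix, confluentVandermonde, Matrix.transpose_apply, Matrix.of_apply,
      eval_monomial]
    split_ifs with h
    · ring
    · rw [Nat.choose_eq_zero_of_lt (not_le.1 h)]
      simp
  · have hN : 0 < N := i.pos
    by_cases h0 : a i = 0
    · simpa [h0] using hN
    · exact (natDegree_lt_iff_degree_lt h0).2 (hdeg i)

/-- **Confluent-Vandermonde triangularity equivalences.** `(A·Vᵀ)[i,j]` is the `nⱼ`-th Hasse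
derivative of `aᵢ` at `λⱼ`; moreover `A·Vᵀ` is upper triangular iff those evaluations vanish
for `j < i`, iff `∏_{j<i}(X − λⱼ)` divides `aᵢ` for every `i`. -/
theorem confluent_vandermonde_triangularity
    (F : Type*) [Field F] [DecidableEq F] (N : ℕ)
    (lam : Fin N → F)
    (a : Fin N → Polynomial F) (hdeg : ∀ i, (a i).degree < (N : WithBot ℕ)) :
    (∀ i j : Fin N,
      (coeffMatrix a * (confluentVandermonde lam)ᵀ) i j =
        (Polynomial.hasseDeriv (multCounter lam j) (a i)).eval (lam j)) ∧
    ((∀ i j : Fin N, j < i → (coeffMatrix a * (confluentVandermonde lam)ᵀ) i j = 0) ↔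
      ∀ i j : Fin N, j < i →
        (Polynomial.hasseDeriv (multCounter lam j) (a i)).eval (lam j) = 0) ∧
    ((∀ i j : Fin N, j < i →
        (Polynomial.hasseDeriv (multCounter lam j) (a i)).eval (lam j) = 0) ↔
      ∀ i : Fin N,
        (∏ j ∈ Finset.univ.filter fun j : Fin N => j < i,
          (X - Polynomial.C (lam j))) ∣ a i) := by
  have he := cvt_entry lam a hdeg
  refine ⟨he, ?_, ?_⟩
  · simp only [he]
  · exact forall_congr' fun i => cvt_main lam (a i) i i.isLt.le
end

section
/- Structured similarity to companion form for nonderogatory upper-triangular matrices: Let F be a field and M an N×N upper-triangular matrix over F whose minimal polynomial equals its characteristic polynomial c_M(X) = ∏_{k=0}^{N−1}(X − M[k,k]). Then there exist scalars d_0,…,d_{N−1} ∈ F such that the family a_0,…,a_{N−1} ∈ F[X] of degree-< N polynomials satisfying the M-recurrence with error coefficients d has invertible coefficient matrix A; consequently M = A·F_{c_M}·A^{-1}. Moreover, for this A the matrix A·V^T is upper triangular and invertible, where V is the confluent Vandermonde matrix of (M[0,0],…,M[N−1,N−1]). -/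
open Polynomial Matrix

theorem aux_cyclic {F : Type*} [Field F] [DecidableEq F] {N : ℕ} (M : Matrix (Fin N) (Fin N) F)
    (hmin : minpoly F M = charProd M) :
    ∃ v : Fin N → F, ∀ p : Polynomial F, (aeval M p) *ᵥ v = 0 → charProd M ∣ p := by
  have hc0 : charProd M ≠ 0 :=
    Finset.prod_ne_zero_iff.2 fun k _ => X_sub_C_ne_zero _
  have hcM : aeval M (charProd M) = 0 := by rw [← hmin]; exact minpoly.aeval F M
  have hroot : ∀ k : Fin N, (charProd M).IsRoot (M k k) := by
    intro k
    exact dvd_iff_isRoot.1 (Finset.dvd_prod_of_mem (fun k => X - Polynomial.C (M k k)) (Finset.mem_univ k))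
  -- cofactors
  have hr : ∀ μ : F, ∃ r : Polynomial F,
      charProd M = (X - Polynomial.C μ) ^ (rootMultiplicity μ (charProd M)) * r ∧
      ¬ r.IsRoot μ := by
    intro μ
    obtain ⟨r, h1, h2⟩ := exists_eq_pow_rootMultiplicity_mul_and_not_dvd (charProd M) hc0 μ
    exact ⟨r, h1, fun h => h2 (dvd_iff_isRoot.2 h)⟩
  choose r hr1 hr2 using hr
  have hw : ∀ μ : F, ∃ (q : Polynomial F) (w : Fin N → F), (charProd M).IsRoot μ →
      charProd M = (X - Polynomial.C μ) * q ∧ (aeval M q) *ᵥ w ≠ 0 := by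
    intro μ
    by_cases hμ : (charProd M).IsRoot μ
    · obtain ⟨q, hq⟩ := dvd_iff_isRoot.2 hμ
      have hq0 : q ≠ 0 := by rintro rfl; simp [hc0] at hq
      have hqM : aeval M q ≠ 0 := by
        intro h
        have h1 := minpoly.dvd F M h
        rw [hmin] at h1
        have h2 := degree_le_of_dvd h1 hq0
        rw [hq, degree_mul, degree_X_sub_C, degree_eq_natDegree hq0] at h2
        norm_cast at h2
        omega
      have : ∃ w, (aeval M q) *ᵥ w ≠ 0 := by
        by_contra! h
        apply hqM
        exact Matrix.ext_of_mulVec_single fun i => by simp only [h, zero_mulVec]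
      obtain ⟨w, hw⟩ := this
      exact ⟨q, w, fun _ => ⟨hq, hw⟩⟩
    · exact ⟨0, 0, fun h => absurd h hμ⟩
  choose q w hqw using hw
  set S : Finset F := Finset.univ.image fun k : Fin N => M k k with hS
  have hSroot : ∀ μ ∈ S, (charProd M).IsRoot μ := by
    intro μ hμ
    obtain ⟨k, -, rfl⟩ := Finset.mem_image.1 hμ
    exact hroot k
  set v : Fin N → F := ∑ μ ∈ S, (aeval M (r μ)) *ᵥ w μ with hv
  have key : ∀ μ ∈ S, (aeval M (q μ)) *ᵥ v ≠ 0 := by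
    intro μ hμ
    obtain ⟨hq, hne⟩ := hqw μ (hSroot μ hμ)
    have hsum : (aeval M (q μ)) *ᵥ v = (aeval M (r μ)) *ᵥ ((aeval M (q μ)) *ᵥ w μ) := by
      rw [hv, Matrix.mulVec_sum, Finset.sum_eq_single_of_mem μ hμ]
      · rw [mulVec_mulVec, mulVec_mulVec, ← map_mul, ← map_mul, mul_comm]
      · intro ν hν hνμ
        have hroot' : (r ν).IsRoot μ := by
          have h1 := hSroot μ hμ
          rw [hr1 ν, IsRoot, eval_mul, mul_eq_zero] at h1
          rcases h1 with h1 | h1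
          · exfalso
            simp only [eval_pow, eval_sub, eval_X, eval_C] at h1
            exact hνμ (sub_eq_zero.1 (pow_eq_zero_iff
              ((rootMultiplicity_pos hc0).2 (hSroot ν hν)).ne' |>.1 h1)).symm
          · exact h1
        obtain ⟨s, hs⟩ := dvd_iff_isRoot.2 hroot'
        have : q μ * r ν = charProd M * s := by rw [hs, hq]; ring
        rw [mulVec_mulVec, ← map_mul, this, map_mul, hcM, zero_mul, zero_mulVec]
    rw [hsum]
    set u := (aeval M (q μ)) *ᵥ w μ with hu
    have hMu : (aeval M (X - Polynomial.C μ)) *ᵥ u = 0 := by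
      rw [hu, mulVec_mulVec, ← map_mul, ← hq, hcM, zero_mulVec]
    obtain ⟨t, ht⟩ : (X - Polynomial.C μ) ∣ r μ - Polynomial.C ((r μ).eval μ) := X_sub_C_dvd_sub_C_eval
    have hru : (aeval M (r μ)) *ᵥ u = (r μ).eval μ • u := by
      have : r μ = t * (X - Polynomial.C μ) + Polynomial.C ((r μ).eval μ) := by
        rw [mul_comm, ← ht]; ring
      rw [this, map_add, map_mul, add_mulVec, ← mulVec_mulVec, hMu, mulVec_zero, ← this, aeval_C,
        zero_add, Algebra.algebraMap_eq_smul_one, smul_mulVec, one_mulVec]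
    rw [hru]
    exact smul_ne_zero (hr2 μ) hne
  refine ⟨v, fun p hp => ?_⟩
  set g := EuclideanDomain.gcd p (charProd M) with hg
  have hgv : (aeval M g) *ᵥ v = 0 := by
    rw [hg, EuclideanDomain.gcd_eq_gcd_ab, map_add, map_mul, map_mul, hcM, zero_mul, add_zero, ← map_mul, mul_comm, map_mul,
      ← mulVec_mulVec, hp, mulVec_zero]
  obtain ⟨h, hh⟩ : g ∣ charProd M := EuclideanDomain.gcd_dvd_right _ _
  have hgp : g ∣ p := EuclideanDomain.gcd_dvd_left _ _
  have hh0 : h ≠ 0 := by rintro rfl; simp [hc0] at hh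
  by_cases hu : IsUnit h
  · have : Associated g (charProd M) := by
      rw [hh]; exact (associated_mul_unit_right g h hu)
    exact this.dvd'.trans hgp
  · exfalso
    obtain ⟨π, hπ, hπh⟩ := WfDvdMonoid.exists_irreducible_factor hu hh0
    have hπc : π ∣ ∏ k : Fin N, (X - Polynomial.C (M k k)) :=
      hπh.trans (show h ∣ charProd M from hh ▸ Dvd.intro_left g rfl)
    obtain ⟨k, -, hk⟩ := (hπ.prime.dvd_finsetProd_iff _).1 hπc
    have hkh : (X - Polynomial.C (M k k)) ∣ h :=
      (hπ.associated_of_dvd (irreducible_X_sub_C _) hk).dvd'.trans hπh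
    obtain ⟨h', rfl⟩ := hkh
    have hkS : M k k ∈ S := Finset.mem_image_of_mem _ (Finset.mem_univ k)
    obtain ⟨hq, -⟩ := hqw (M k k) (hroot k)
    have : q (M k k) = h' * g := by
      apply mul_left_cancel₀ (X_sub_C_ne_zero (M k k))
      rw [← hq, hh]; ring
    apply key _ hkS
    rw [this, map_mul, ← mulVec_mulVec, hgv, mulVec_zero]

theorem aux_coeff_divX {F : Type*} [Field F] (p : Polynomial F) (n k : ℕ) :
    (divX^[n] p).coeff k = p.coeff (k + n) := by
  induction n generalizing k with
  | zero => rfl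
  | succ n ih => rw [Function.iterate_succ_apply', coeff_divX, ih]; congr 1; omega

theorem aux_prod_split {F : Type*} [Field F] [DecidableEq F] {N : ℕ} (lam : Fin N → F) (i : Fin N) (μ : F) :
    ∃ s : Polynomial F, s.eval μ ≠ 0 ∧
      ∏ k ∈ Finset.univ.filter (fun k : Fin N => k < i), (X - Polynomial.C (lam k)) =
        (X - Polynomial.C μ) ^ (Finset.univ.filter fun k : Fin N => k < i ∧ lam k = μ).card * s := by
  refine ⟨∏ k ∈ Finset.univ.filter (fun k : Fin N => k < i ∧ ¬ lam k = μ),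
    (X - Polynomial.C (lam k)), ?_, ?_⟩
  · rw [eval_prod, Finset.prod_ne_zero_iff]
    intro k hk
    simp only [Finset.mem_filter] at hk
    simpa [sub_eq_zero] using fun h : μ = lam k => hk.2.2 h.symm
  · rw [← Finset.prod_filter_mul_prod_filter_not (Finset.univ.filter (fun k : Fin N => k < i)) (fun k => lam k = μ),
      Finset.filter_filter, Finset.filter_filter]
    congr 1
    rw [← Finset.prod_const]
    apply Finset.prod_congr rfl
    intro k hk
    simp only [Finset.mem_filter] at hk
    rw [hk.2.2]

theorem aux_taylor {F : Type*} [Field F] (μ : F) (m n : ℕ) (t : Polynomial F) :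
    (hasseDeriv n ((X - Polynomial.C μ) ^ m * t)).eval μ =
      if n < m then 0 else (taylor μ t).coeff (n - m) := by
  rw [← taylor_coeff, taylor_mul, taylor_pow]
  have : taylor μ (X - Polynomial.C μ) = X := by
    rw [map_sub, taylor_X, taylor_C]; ring
  rw [this, coeff_X_pow_mul']
  by_cases h : n < m
  · rw [if_pos h, if_neg (by omega)]
  · rw [if_neg h, if_pos (by omega)]

theorem aux_vand {F : Type*} [Field F] [DecidableEq F] {N : ℕ} (lam : Fin N → F)
    (p : Polynomial F) (hp : p.degree < (N : WithBot ℕ)) (i : Fin N) :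
    ∑ k : Fin N, p.coeff k * confluentVandermonde lam i k =
      (hasseDeriv (multCounter lam i) p).eval (lam i) := by
  set n := multCounter lam i with hn
  have hsum : p = ∑ k : Fin N, monomial (k : ℕ) (p.coeff k) := by
    rw [Fin.sum_univ_eq_sum_range (fun k => monomial k (p.coeff k)) N]
    by_cases hN : p = 0
    · simp [hN]
    · exact p.as_sum_range' N ((natDegree_lt_iff_degree_lt hN).2 hp)
  conv_rhs => rw [hsum]
  rw [map_sum, eval_finsetSum]
  apply Finset.sum_congr rfl
  intro k _
  rw [hasseDeriv_monomial, eval_monomial]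
  simp only [confluentVandermonde, Matrix.of_apply, ← hn]
  split_ifs with h
  · ring
  · rw [Nat.choose_eq_zero_of_lt (by omega)]; simp

theorem aux_charProd_natDegree {F : Type*} [Field F] {N : ℕ} (M : Matrix (Fin N) (Fin N) F) :
    (charProd M).natDegree = N ∧ (charProd M).Monic := by
  refine ⟨?_, monic_prod_of_monic _ _ fun k _ => monic_X_sub_C _⟩
  unfold charProd
  rw [natDegree_prod_of_monic _ _ fun k _ => monic_X_sub_C _]
  simp

theorem aux_prod_succ {F : Type*} [Field F] {N : ℕ} (lam : Fin N → F) (i : Fin N) :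
    ∏ k ∈ Finset.univ.filter (fun k : Fin N => k ≤ i), (X - Polynomial.C (lam k)) =
      (X - Polynomial.C (lam i)) *
        ∏ k ∈ Finset.univ.filter (fun k : Fin N => k < i), (X - Polynomial.C (lam k)) := by
  rw [← Finset.prod_insert (s := Finset.univ.filter (fun k : Fin N => k < i)) (a := i)
    (f := fun k => X - Polynomial.C (lam k)) (by simp)]
  apply Finset.prod_congr _ fun _ _ => rfl
  ext k
  simp [le_iff_eq_or_lt]

theorem aux_vand_unit {F : Type*} [Field F] [DecidableEq F] {N : ℕ} (lam : Fin N → F) :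
    IsUnit (confluentVandermonde lam) := by
  rw [← Matrix.mulVec_injective_iff_isUnit]
  rw [← Matrix.coe_mulVecLin, injective_iff_map_eq_zero]
  intro x hx
  rw [Matrix.mulVecLin_apply] at hx
  set p : Polynomial F := ∑ k : Fin N, monomial (k : ℕ) (x k) with hp
  have hcoeff : ∀ k : Fin N, p.coeff k = x k := by
    intro k
    simp [hp, finsetSum_coeff, coeff_monomial, Fin.val_inj]
  have hdeg : p.degree < (N : WithBot ℕ) := by
    rw [degree_lt_iff_coeff_zero]
    intro m hm
    rw [hp, finsetSum_coeff]
    apply Finset.sum_eq_zero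
    intro k _
    rw [coeff_monomial, if_neg (by omega)]
  have hz : ∀ i, (hasseDeriv (multCounter lam i) p).eval (lam i) = 0 := by
    intro i
    rw [← aux_vand lam p hdeg]
    have := congrFun hx i
    simp only [Matrix.mulVec, dotProduct, Pi.zero_apply] at this
    rw [← this]
    apply Finset.sum_congr rfl
    intro k _
    rw [hcoeff, mul_comm]
  have hdvd : ∀ m : ℕ, ∏ k ∈ Finset.univ.filter (fun k : Fin N => (k : ℕ) < m),
      (X - Polynomial.C (lam k)) ∣ p := by
    intro m
    induction m with
    | zero => simp
    | succ m ih =>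
      by_cases hm : m < N
      · set i : Fin N := ⟨m, hm⟩ with hi
        have e1 : (Finset.univ.filter (fun k : Fin N => (k : ℕ) < m + 1)) =
            Finset.univ.filter (fun k : Fin N => k ≤ i) := by
          ext k; simp [hi, Fin.le_def]
        have e2 : (Finset.univ.filter (fun k : Fin N => (k : ℕ) < m)) =
            Finset.univ.filter (fun k : Fin N => k < i) := by
          ext k; simp [hi, Fin.lt_def]
        rw [e1, aux_prod_succ]
        rw [e2] at ih
        obtain ⟨t, ht⟩ := ih
        obtain ⟨s, hs, hs'⟩ := aux_prod_split lam i (lam i)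
        have h := hz i
        rw [ht, hs', mul_assoc] at h
        change (hasseDeriv (multCounter lam i) ((X - Polynomial.C (lam i)) ^ (multCounter lam i) * (s * t))).eval (lam i) = 0 at h
        rw [aux_taylor, if_neg (lt_irrefl _), Nat.sub_self, taylor_coeff_zero, eval_mul] at h
        obtain ⟨t', ht'⟩ := dvd_iff_isRoot.2 ((mul_eq_zero.1 h).resolve_left hs)
        exact ⟨t', by rw [ht, ht']; ring⟩
      · convert! ih using 2
        ext k; simp; omega
  have h := hdvd N
  have hp0 : p = 0 := by
    apply eq_zero_of_dvd_of_degree_lt h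
    rw [Finset.filter_true_of_mem (by simp), degree_prod]
    simpa using hdeg
  funext k
  rw [← hcoeff, hp0]; simp

/-- **Structured similarity to companion form for nonderogatory upper-triangular matrices.**
If `M` is upper triangular with minimal polynomial equal to its characteristic polynomial
`c_M = ∏ₖ (X − M[k,k])`, then some choice of error coefficients `d` yields a degree-`< N`
family `a` satisfying the `M`-recurrence whose coefficient matrix `A` is invertible, so that
`M = A·F_{c_M}·A⁻¹`; moreover `A·Vᵀ` is upper triangular and invertible. -/
theorem nonderogatory_structured_similarity
    (F : Type*) [Field F] [DecidableEq F] (N : ℕ)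
    (M : Matrix (Fin N) (Fin N) F)
    (hupper : ∀ i j : Fin N, j < i → M i j = 0)
    (hmin : minpoly F M = charProd M) :
    ∃ (d : Fin N → F) (a : Fin N → Polynomial F),
      (∀ i, (a i).degree < (N : WithBot ℕ)) ∧
      SatisfiesMRec M d a ∧
      IsUnit (coeffMatrix a) ∧
      M = coeffMatrix a * companionForm (charProd M) * (coeffMatrix a)⁻¹ ∧
      (∀ i j : Fin N, j < i →
        (coeffMatrix a * (confluentVandermonde fun k => M k k)ᵀ) i j = 0) ∧
      IsUnit (coeffMatrix a * (confluentVandermonde fun k => M k k)ᵀ) := by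

  obtain ⟨v, hv⟩ := aux_cyclic M hmin
  obtain ⟨hdegc, hmonic⟩ := aux_charProd_natDegree M
  set c := charProd M with hc
  have hcM : aeval M c = 0 := by rw [← hmin]; exact minpoly.aeval F M
  set g : ℕ → Fin N → F := fun n => (aeval M (divX^[n] c)) *ᵥ v with hg
  have hg0 : g 0 = 0 := by simp [hg, hcM]
  have hbig : ∀ n, N < n → g n = 0 := by
    intro n hn
    have : divX^[n] c = 0 := by
      ext k
      rw [aux_coeff_divX, coeff_eq_zero_of_natDegree_lt (by omega), coeff_zero]
    simp [hg, this]
  have hgN : g N = v := by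
    have : divX^[N] c = 1 := by
      ext k
      rw [aux_coeff_divX, coeff_one]
      split_ifs with h
      · subst h
        have h1 := hmonic.coeff_natDegree
        rw [hdegc] at h1
        simpa using h1
      · rw [coeff_eq_zero_of_natDegree_lt (by omega)]
    simp [hg, this]
  have hgM : ∀ n, M *ᵥ g (n + 1) = g n - c.coeff n • v := by
    intro n
    have h1 := divX_mul_X_add (divX^[n] c)
    rw [aux_coeff_divX, zero_add, mul_comm] at h1
    have h2 : g n = (aeval M (X * (divX^[n] c).divX + Polynomial.C (c.coeff n))) *ᵥ v := by
      rw [h1]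
    rw [h2, map_add, map_mul, aeval_X, aeval_C, add_mulVec, Algebra.algebraMap_eq_smul_one,
      smul_mulVec, one_mulVec, add_sub_cancel_right, ← mulVec_mulVec, hg]
    simp only [Function.iterate_succ_apply']
  set a : Fin N → Polynomial F := fun i => ∑ k : Fin N, monomial (k : ℕ) (g (k + 1) i) with ha
  have hcoeff : ∀ i n, (a i).coeff n = g (n + 1) i := by
    intro i n
    rw [ha]
    simp only [finsetSum_coeff, coeff_monomial]
    by_cases hn : n < N
    · rw [Finset.sum_eq_single ⟨n, hn⟩]
      · simp
      · intro k _ hk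
        rw [if_neg]
        intro h; exact hk (Fin.ext h)
      · simp
    · rw [hbig (n + 1) (by omega), Finset.sum_eq_zero]
      · rfl
      · intro k _
        rw [if_neg (by omega)]
  have hdeg : ∀ i, (a i).degree < (N : WithBot ℕ) := by
    intro i
    rw [degree_lt_iff_coeff_zero]
    intro m hm
    rw [hcoeff, hbig _ (by omega)]; rfl
  have hrec : SatisfiesMRec M v a := by
    intro i
    have hfull : X * a i = (∑ j, Polynomial.C (M i j) * a j) + Polynomial.C (v i) * c := by
      ext n
      have hM : ∀ n, ∑ j, M i j * g (n + 1) j = g n i - c.coeff n * v i := by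
        intro n
        exact congrFun (hgM n) i
      rw [coeff_add, finsetSum_coeff, coeff_C_mul]
      simp only [coeff_C_mul, hcoeff, hM]
      cases n with
      | zero => rw [coeff_X_mul_zero, hg0]; simp [mul_comm]
      | succ n => rw [coeff_X_mul, hcoeff]; ring
    have hsplit : ∑ j, Polynomial.C (M i j) * a j = Polynomial.C (M i i) * a i +
        ∑ j ∈ Finset.univ.filter fun j : Fin N => i < j, Polynomial.C (M i j) * a j := by
      rw [← Finset.sum_insert (s := Finset.univ.filter (fun j : Fin N => i < j)) (a := i)
        (f := fun j => Polynomial.C (M i j) * a j) (by simp)]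
      symm
      apply Finset.sum_subset (Finset.subset_univ _)
      intro j _ hj
      simp only [Finset.mem_insert, Finset.mem_filter, Finset.mem_univ, true_and, not_or, not_lt] at hj
      rw [hupper i j (lt_of_le_of_ne hj.2 hj.1)]; simp
    rw [sub_mul, hfull, hsplit]; ring
  have hunit : IsUnit (coeffMatrix a) := by
    rw [← Matrix.mulVec_injective_iff_isUnit, ← Matrix.coe_mulVecLin, injective_iff_map_eq_zero]
    intro x hx
    rw [Matrix.mulVecLin_apply] at hx
    set p : Polynomial F := ∑ j : Fin N, Polynomial.C (x j) * divX^[(j : ℕ) + 1] c with hp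
    have hpc : ∀ n, p.coeff n = ∑ j : Fin N, x j * c.coeff (n + (j + 1)) := by
      intro n
      simp only [hp, finsetSum_coeff, coeff_C_mul, aux_coeff_divX]
    have hpv : (aeval M p) *ᵥ v = 0 := by
      rw [← hx, hp, map_sum, Matrix.sum_mulVec]
      funext i
      simp only [Finset.sum_apply, Matrix.mulVec, dotProduct, coeffMatrix, Matrix.of_apply, hcoeff]
      apply Finset.sum_congr rfl
      intro j _
      have : (aeval M (Polynomial.C (x j) * divX^[(j : ℕ) + 1] c)) *ᵥ v = x j • g (j + 1) := by
        rw [map_mul, aeval_C, Algebra.algebraMap_eq_smul_one, smul_mul_assoc, one_mul, smul_mulVec]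
      have h := congrFun this i
      simp only [Pi.smul_apply, smul_eq_mul, Matrix.mulVec, dotProduct] at h
      rw [h, mul_comm]
    have hp0 : p = 0 := by
      apply eq_zero_of_dvd_of_degree_lt (hv p hpv)
      rw [degree_eq_natDegree hmonic.ne_zero, hdegc, degree_lt_iff_coeff_zero]
      intro m hm
      rw [hpc]
      apply Finset.sum_eq_zero
      intro j _
      rw [coeff_eq_zero_of_natDegree_lt (by omega), mul_zero]
    have hx0 : ∀ n, ∀ h : n < N, x ⟨n, h⟩ = 0 := by
      intro n
      induction n using Nat.strong_induction_on with
      | _ n ih =>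
        intro h
        have h1 := hpc (N - 1 - n)
        rw [hp0, coeff_zero, Finset.sum_eq_single ⟨n, h⟩] at h1
        · have h2 : N - 1 - n + (n + 1) = N := by omega
          have h3 := hmonic.coeff_natDegree
          rw [hdegc] at h3
          simp only [h2, h3, mul_one] at h1
          exact h1.symm
        · intro j _ hj
          rcases lt_trichotomy (j : ℕ) n with hlt | heq | hgt
          · rw [ih j hlt j.2, zero_mul]
          · exact absurd (Fin.ext heq) hj
          · rw [coeff_eq_zero_of_natDegree_lt (by omega), mul_zero]
        · simp
    funext k
    exact hx0 k k.2
  have hsim : M * coeffMatrix a = coeffMatrix a * companionForm c := by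
    ext i j
    have hM : ∑ k, M i k * g (j + 1) k = g j i - c.coeff j * v i := congrFun (hgM j) i
    simp only [Matrix.mul_apply, coeffMatrix, Matrix.of_apply, hcoeff, hM, companionForm]
    have hsplit : ∀ k : Fin N, g (k + 1) i * (if (k : ℕ) = N - 1 then -(c.coeff (j : ℕ))
        else if (j : ℕ) = (k : ℕ) + 1 then 1 else 0) =
        (if (k : ℕ) = N - 1 then -(c.coeff (j : ℕ)) * v i else 0) +
        (if (j : ℕ) = (k : ℕ) + 1 then g j i else 0) := by
      intro k
      have hj := j.2
      by_cases h1 : (k : ℕ) = N - 1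
      · rw [if_pos h1, if_pos h1, if_neg (by omega), add_zero, h1, Nat.sub_add_cancel (by omega),
          hgN, mul_comm]
      · rw [if_neg h1, if_neg h1, zero_add]
        split_ifs with h2
        · rw [h2, mul_one]
        · rw [mul_zero]
    rw [Finset.sum_congr rfl fun k _ => hsplit k, Finset.sum_add_distrib]
    have hj := j.2
    rw [Finset.sum_eq_single ⟨N - 1, by omega⟩, if_pos rfl]
    · have : ∑ k : Fin N, (if (j : ℕ) = (k : ℕ) + 1 then g j i else 0) = g j i := by
        by_cases hj0 : (j : ℕ) = 0
        · rw [hj0, hg0]; simp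
        · rw [Finset.sum_eq_single ⟨j - 1, by omega⟩, if_pos]
          · simp only []; omega
          · intro k _ hk
            rw [if_neg]
            intro h
            apply hk
            apply Fin.ext
            simp only []
            omega
          · simp
      rw [this]; ring
    · intro k _ hk
      rw [if_neg]
      intro h; exact hk (Fin.ext h)
    · simp
  have hdvd : ∀ n, ∀ i : Fin N, N - i ≤ n →
      ∏ k ∈ Finset.univ.filter (fun k : Fin N => k < i), (X - Polynomial.C (M k k)) ∣ a i := by
    intro n
    induction n with
    | zero => intro i hi; have := i.2; omega
    | succ n ih =>
      intro i hi
      apply (mul_dvd_mul_iff_left (X_sub_C_ne_zero (M i i))).1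
      rw [← aux_prod_succ (fun k => M k k) i, hrec i]
      apply dvd_add
      · apply Finset.dvd_sum
        intro j hj
        simp only [Finset.mem_filter, Finset.mem_univ, true_and] at hj
        apply Dvd.dvd.mul_left
        refine dvd_trans ?_ (ih j ?_)
        · apply Finset.prod_dvd_prod_of_subset
          intro k hk
          simp only [Finset.mem_filter, Finset.mem_univ, true_and] at hk ⊢
          exact lt_of_le_of_lt hk hj
        · have := Fin.lt_def.1 hj
          omega
      · apply Dvd.dvd.mul_left
        exact Finset.prod_dvd_prod_of_subset _ _ _ (Finset.subset_univ _)
  refine ⟨v, a, hdeg, hrec, hunit, ?_, ?_, ?_⟩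
  · rw [← hsim, Matrix.mul_nonsing_inv_cancel_right]
    exact (Matrix.isUnit_iff_isUnit_det _).1 hunit
  · intro i j hji
    have h1 : (coeffMatrix a * (confluentVandermonde fun k => M k k)ᵀ) i j =
        (hasseDeriv (multCounter (fun k => M k k) j) (a i)).eval (M j j) := by
      rw [← aux_vand (fun k => M k k) (a i) (hdeg i) j]
      rfl
    obtain ⟨t, ht⟩ := hdvd _ i le_rfl
    obtain ⟨s, -, hs⟩ := aux_prod_split (fun k => M k k) i (M j j)
    rw [h1, ht, hs, mul_assoc, aux_taylor, if_pos]
    apply Finset.card_lt_card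
    rw [Finset.ssubset_iff_of_subset]
    · exact ⟨j, by simp [hji], by simp⟩
    · intro k hk
      simp only [Finset.mem_filter, Finset.mem_univ, true_and] at hk ⊢
      exact ⟨hk.1.trans hji, hk.2⟩
  · exact hunit.mul (by rw [Matrix.isUnit_transpose]; exact aux_vand_unit _)
end

section
/- High-order coefficients of a recurrence-width family depend only on high-order coefficients of the initial polynomials: Let F be a field, t ≥ 1, N ≥ t, D ≥ 0, and let g_{i,j} ∈ F[X] with deg(g_{i,j}) ≤ j for t ≤ i ≤ N−1 and 1 ≤ j ≤ t. Let (f_i)_{0≤i<N} and (f'_i)_{0≤i<N} be two families of polynomials, both satisfying the same recurrence f_i = Σ_{j=1}^{t} g_{i,j}·f_{i−j} for every t ≤ i ≤ N−1. If deg(f_i − f'_i) < D for every i < t, then deg(f_i − f'_i) < D + i for every 0 ≤ i < N; in particular, for every i and every k ≥ D + i, the coefficient of X^k in f_i equals the coefficient of X^k in f'_i. -/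
open Polynomial

/-- **High-order coefficients of a recurrence-width family depend only on high-order
coefficients of the initial polynomials.** If `f` and `f'` both satisfy the same width-`t`
degree-(1,0) recurrence and `deg(fᵢ − f'ᵢ) < D` for `i < t`, then `deg(fᵢ − f'ᵢ) < D + i`
for all `i < N`; in particular the coefficients of `X^k` in `fᵢ` and `f'ᵢ` agree for all
`k ≥ D + i`. -/
theorem high_order_coefficients_recurrence
    (F : Type*) [Field F] (t N D : ℕ) (ht : 1 ≤ t) (htN : t ≤ N)
    (g : ℕ → ℕ → Polynomial F)
    (hdeg : ∀ i j : ℕ, t ≤ i → i ≤ N - 1 → 1 ≤ j → j ≤ t → (g i j).degree ≤ (j : WithBot ℕ))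
    (f f' : ℕ → Polynomial F)
    (hf : ∀ i, t ≤ i → i < N → f i = ∑ j ∈ Finset.Icc 1 t, g i j * f (i - j))
    (hf' : ∀ i, t ≤ i → i < N → f' i = ∑ j ∈ Finset.Icc 1 t, g i j * f' (i - j))
    (hbase : ∀ i, i < t → (f i - f' i).degree < (D : WithBot ℕ)) :
    (∀ i, i < N → (f i - f' i).degree < ((D + i : ℕ) : WithBot ℕ)) ∧
    (∀ i, i < N → ∀ k, D + i ≤ k → (f i).coeff k = (f' i).coeff k) := by
  have key : ∀ i, i < N → ∀ k, D + i ≤ k → (f i - f' i).coeff k = 0 := by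
    intro i
    induction i using Nat.strong_induction_on with
    | _ i ih =>
      intro hi k hk
      by_cases hit : i < t
      · exact (degree_lt_iff_coeff_zero _ _).1 (hbase i hit) k (by omega)
      · have hti : t ≤ i := by omega
        rw [hf i hti hi, hf' i hti hi, ← Finset.sum_sub_distrib, finsetSum_coeff]
        refine Finset.sum_eq_zero fun j hj => ?_
        rw [Finset.mem_Icc] at hj
        rw [← mul_sub, coeff_mul]
        refine Finset.sum_eq_zero fun p hp => ?_
        rw [Finset.HasAntidiagonal.mem_antidiagonal] at hp
        by_cases hpj : p.1 ≤ j
        · rw [ih (i - j) (by omega) (by omega) p.2 (by omega), mul_zero]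
        · have h := hdeg i j hti (by omega) hj.1 hj.2
          rw [(degree_le_iff_coeff_zero _ _).1 h p.1 (by exact_mod_cast not_le.1 hpj), zero_mul]
  refine ⟨fun i hi => (degree_lt_iff_coeff_zero _ _).2 (key i hi), fun i hi k hk => ?_⟩
  have h := key i hi k hk
  rwa [coeff_sub, sub_eq_zero] at h
end
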